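/- Let A be a standard Young tableau of shape α ⊢ m and let q > 0 be a real number. Then the ratio (Σ_{T ∈ T_n(A)} q^{maj(T_{>m})}) / (Σ_{T ∈ T_n} q^{maj(T_{>m})}) converges as n → ∞ to [ Σ_{j=0}^{m} [m choose j]_q · [j]_q! · (1-q̄)^j · Σ_{μ ⊢ j} f^{α/μ}(q) ] / [ Σ_{j=0}^{m} [m]_q! · t_j · C(m,j) · (1-q̄)^j ], where q̄ = min(q, q^{-1}), t_j is the number of involutions in S_j, and the inner sum is over partitions μ of j with μ ⊆ α. -/

import Mathlib

open Finset

namespace QT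

/-- The major index of a permutation of `Fin n` (sum of descents,
with positions written `1,...,n-1` as in one-line notation). -/
def maj {n : ℕ} (π : Equiv.Perm (Fin n)) : ℕ :=
  ∑ i ∈ Finset.range n,
    if h : i + 1 < n then
      (if π ⟨i + 1, h⟩ < π ⟨i, by omega⟩ then i + 1 else 0)
    else 0

/-- `imaj π = maj π⁻¹`. -/
def imaj {n : ℕ} (π : Equiv.Perm (Fin n)) : ℕ := maj π⁻¹

/-- The permutation of `Fin k` order-isomorphic to the word `v 0, v 1, ..., v (k-1)`. -/
noncomputable def standardize {n k : ℕ} (v : Fin k → Fin n) (hv : Function.Injective v) :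
    Equiv.Perm (Fin k) :=
  Equiv.ofBijective
    (fun i => (Finset.orderIsoOfFin (Finset.image v Finset.univ)
        (by rw [Finset.card_image_of_injective _ hv, Finset.card_univ, Fintype.card_fin])).symm
        ⟨v i, Finset.mem_image_of_mem v (Finset.mem_univ i)⟩)
    (Finite.injective_iff_bijective.mp (fun i j hij => by
      have h2 := (Finset.orderIsoOfFin _ _).symm.injective hij
      exact hv (congrArg Subtype.val h2)))

/-- `π^{≤k}` : the permutation of `Fin k` order-isomorphic to the first `k` letters of `π`. -/
noncomputable def pInit {n : ℕ} (π : Equiv.Perm (Fin n)) (k : ℕ) (hk : k ≤ n) :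
    Equiv.Perm (Fin k) :=
  standardize (fun i => π (Fin.castLE hk i))
    (fun i j h => Fin.castLE_injective hk (π.injective h))

/-- `π^{>k}` : the permutation of `Fin (n-k)` order-isomorphic to the last `n - k` letters of `π`. -/
noncomputable def pTail {n : ℕ} (π : Equiv.Perm (Fin n)) (k : ℕ) :
    Equiv.Perm (Fin (n - k)) :=
  standardize (fun i => π ⟨k + (i : ℕ), by have := i.isLt; omega⟩)
    (fun i j h => by
      have h2 : k + (i : ℕ) = k + (j : ℕ) := congrArg Fin.val (π.injective h)
      exact Fin.ext (by omega))

/-- `π_{≤k}` : the permutation of `Fin k` order-isomorphic to the subword of `π`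
consisting of the `k` smallest values.  (Equivalently `((π⁻¹)^{≤k})⁻¹`.) -/
noncomputable def vLow {n : ℕ} (π : Equiv.Perm (Fin n)) (k : ℕ) (hk : k ≤ n) :
    Equiv.Perm (Fin k) := (pInit π⁻¹ k hk)⁻¹

/-- `π_{>k}` : the permutation of `Fin (n-k)` order-isomorphic to the subword of `π`
consisting of the values `> k`.  (Equivalently `((π⁻¹)^{>k})⁻¹`.) -/
noncomputable def vHigh {n : ℕ} (π : Equiv.Perm (Fin n)) (k : ℕ) :
    Equiv.Perm (Fin (n - k)) := (pTail π⁻¹ k)⁻¹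

/-- The set `I_n` of involutions in `S_n`. -/
def involutions (n : ℕ) : Finset (Equiv.Perm (Fin n)) :=
  Finset.univ.filter fun π => π * π = 1

-- `I_n(σ) = {π ∈ I_n : π_{≤m} = σ}`.
open scoped Classical in
noncomputable def involutionsC (n : ℕ) {m : ℕ} (σ : Equiv.Perm (Fin m)) :
    Finset (Equiv.Perm (Fin n)) :=
  (involutions n).filter fun π => ∃ h : m ≤ n, vLow π m h = σ

-- `S_n(σ,τ) = {π ∈ S_n : π_{≤a} = σ, π^{≤b} = τ}`.
open scoped Classical in
noncomputable def permsC (n : ℕ) {a b : ℕ} (σ : Equiv.Perm (Fin a)) (τ : Equiv.Perm (Fin b)) :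
    Finset (Equiv.Perm (Fin n)) :=
  Finset.univ.filter fun π => ∃ (ha : a ≤ n) (hb : b ≤ n), vLow π a ha = σ ∧ pInit π b hb = τ

-- The j-set `J(σ) = {j : σ^{≤j} is an involution}`.
open scoped Classical in
noncomputable def jSet {m : ℕ} (σ : Equiv.Perm (Fin m)) : Finset ℕ :=
  (Finset.range (m + 1)).filter fun j => ∃ h : j ≤ m, pInit σ j h * pInit σ j h = 1

-- The j₂-set `J(σ,τ) = {j : σ^{≤j} = τ_{≤j}}`.
open scoped Classical in
noncomputable def j2Set {a b : ℕ} (σ : Equiv.Perm (Fin a)) (τ : Equiv.Perm (Fin b)) :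
    Finset ℕ :=
  (Finset.range (min a b + 1)).filter fun j =>
    ∃ (ha : j ≤ a) (hb : j ≤ b), pInit σ j ha = vLow τ j hb

/-- A set of nonnegative integers is a j₂-set if it is `J(σ,τ)` for some pair of
permutations. -/
def IsJ2Set (S : Finset ℕ) : Prop :=
  ∃ (a b : ℕ) (σ : Equiv.Perm (Fin a)) (τ : Equiv.Perm (Fin b)), S = j2Set σ τ

-- The number of j₂-sets with largest element `n`.
open scoped Classical in
noncomputable def j2count (n : ℕ) : ℕ :=
  ((Finset.range (n + 1)).powerset.filter
    fun S => IsJ2Set S ∧ n ∈ S ∧ ∀ x ∈ S, x ≤ n).card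

/-- `[n]_q = 1 + q + ⋯ + q^{n-1}`. -/
def qInt (q : ℝ) (n : ℕ) : ℝ := ∑ i ∈ Finset.range n, q ^ i

/-- The q-factorial `[n]_q! = ∏_{i=1}^n (1 + q + ⋯ + q^{i-1})`. -/
def qFact (q : ℝ) (n : ℕ) : ℝ := ∏ i ∈ Finset.range n, qInt q (i + 1)

/-- The Gaussian binomial coefficient `[n choose k]_q = [n]_q!/([k]_q! [n-k]_q!)`,
defined via the q-Pascal recursion. -/
def qBinom (q : ℝ) : ℕ → ℕ → ℝ
  | _, 0 => 1
  | 0, _ + 1 => 0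
  | n + 1, k + 1 => qBinom q n k + q ^ (k + 1) * qBinom q n (k + 1)

/-- `t_n(q) = Σ_{π ∈ I_n} q^{maj π}`. -/
noncomputable def tq (q : ℝ) (n : ℕ) : ℝ := ∑ π ∈ involutions n, q ^ maj π

/-- `A_n(p,q) = Σ_{π ∈ S_n} p^{imaj π} q^{maj π}`. -/
noncomputable def Apq (p q : ℝ) (n : ℕ) : ℝ :=
  ∑ π : Equiv.Perm (Fin n), p ^ imaj π * q ^ maj π



/-- The `k × k` square Young diagram. -/
def square (k : ℕ) : YoungDiagram :=
  ⟨Finset.range k ×ˢ Finset.range k, by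
    intro a b hab ha
    rw [Finset.mem_coe, Finset.mem_product] at ha ⊢
    simp only [Finset.mem_range] at ha ⊢
    exact ⟨lt_of_le_of_lt hab.1 ha.1, lt_of_le_of_lt hab.2 ha.2⟩⟩

-- All Young diagrams contained in `l`.
open scoped Classical in
noncomputable def subDiagrams (l : YoungDiagram) : Finset YoungDiagram :=
  (l.cells.powerset.filter fun (s : Finset (ℕ × ℕ)) => IsLowerSet ((s : Set (ℕ × ℕ)))).attach.image
    fun s => YoungDiagram.mk s.1 (by
      have hs := s.2
      rw [Finset.mem_filter] at hs
      exact hs.2)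

/-- All Young diagrams with `k` cells (i.e. partitions of `k`). -/
noncomputable def diagramsOfCard (k : ℕ) : Finset YoungDiagram :=
  (subDiagrams (square k)).filter fun d => d.card = k

/-- A chain of Young diagrams each obtained from the previous by adding one cell.
Such chains of length `n` starting at `μ` and ending at `λ` are exactly the skew standard
Young tableaux of shape `λ/μ` with `n` cells. -/
def IsSYTChain {n : ℕ} (c : Fin (n + 1) → YoungDiagram) : Prop :=
  ∀ i : ℕ, ∀ _h : i < n,
    c ⟨i, by omega⟩ ≤ c ⟨i + 1, by omega⟩ ∧
      (c ⟨i + 1, by omega⟩).card = (c ⟨i, by omega⟩).card + 1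

-- The (skew) standard Young tableaux of shape `λ/μ` and size `n`, encoded as chains.
open scoped Classical in
noncomputable def skewSYT (mu lam : YoungDiagram) (n : ℕ) :
    Finset (Fin (n + 1) → YoungDiagram) :=
  (Fintype.piFinset fun _ : Fin (n + 1) => subDiagrams lam).filter
    fun c => c 0 = mu ∧ c (Fin.last n) = lam ∧ IsSYTChain c

-- `T_n` : all standard Young tableaux of size `n` (encoded as chains starting at `⊥`).
open scoped Classical in
noncomputable def allSYT (n : ℕ) : Finset (Fin (n + 1) → YoungDiagram) :=
  (Fintype.piFinset fun _ : Fin (n + 1) => subDiagrams (square n)).filter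
    fun c => c 0 = ⊥ ∧ IsSYTChain c

/-- The row in which the `(i+1)`-st cell of the chain `c` is added. -/
def rowOfStep {n : ℕ} (c : Fin (n + 1) → YoungDiagram) (i : ℕ) : ℕ :=
  if h : i < n then
    ((c ⟨i + 1, by omega⟩).cells \ (c ⟨i, by omega⟩).cells).sup Prod.fst
  else 0

/-- The major index of a (skew) standard Young tableau, encoded as a chain:
the sum of all `i` such that `i+1` lies in a lower row than `i`. -/
def chainMaj {n : ℕ} (c : Fin (n + 1) → YoungDiagram) : ℕ :=
  ∑ i ∈ Finset.range n,
    if i + 1 < n ∧ rowOfStep c i < rowOfStep c (i + 1) then i + 1 else 0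

/-- `f^{λ/μ}(q) = Σ_{sh(T) = λ/μ} q^{maj T}`, where `n` is the number of cells of `λ/μ`. -/
noncomputable def fSkew (mu lam : YoungDiagram) (n : ℕ) (q : ℝ) : ℝ :=
  ∑ c ∈ skewSYT mu lam n, q ^ chainMaj c

/-- `T_{>m}` : the skew tableau obtained from `T` by removing the entries `≤ m`. -/
def tailChain {n : ℕ} (c : Fin (n + 1) → YoungDiagram) (m : ℕ) :
    Fin (n - m + 1) → YoungDiagram :=
  fun i => c ⟨min (m + (i : ℕ)) n, by omega⟩

/-- `T` contains `A`, i.e. `T_{≤a} = A`. -/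
def containsT {n a : ℕ} (T : Fin (n + 1) → YoungDiagram)
    (A : Fin (a + 1) → YoungDiagram) : Prop :=
  ∀ i : Fin (a + 1), T ⟨min (i : ℕ) n, by omega⟩ = A i

-- `T_n(A,B)` : pairs of standard Young tableaux of the same shape, of size `n`,
-- containing `A` and `B` respectively.
open scoped Classical in
noncomputable def pairSYT (n : ℕ) {a b : ℕ} (A : Fin (a + 1) → YoungDiagram)
    (B : Fin (b + 1) → YoungDiagram) :
    Finset ((Fin (n + 1) → YoungDiagram) × (Fin (n + 1) → YoungDiagram)) :=
  ((allSYT n) ×ˢ (allSYT n)).filter fun PQ =>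
    PQ.1 (Fin.last n) = PQ.2 (Fin.last n) ∧ containsT PQ.1 A ∧ containsT PQ.2 B

/-- The empty standard Young tableau. -/
def emptySYT : Fin (0 + 1) → YoungDiagram := fun _ => ⊥

/-- Schensted row insertion: insert `x` into the row `r`, returning the new row and
the bumped entry (if any). -/
def insertRow : List ℕ → ℕ → List ℕ × Option ℕ
  | [], x => ([x], none)
  | y :: ys, x =>
    if x < y then (x :: ys, some y)
    else
      let p := insertRow ys x
      (y :: p.1, p.2)

/-- Schensted insertion of `x` into a tableau given as a list of rows. -/
def insertTab : List (List ℕ) → ℕ → List (List ℕ)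
  | [], x => [[x]]
  | r :: rs, x =>
    match insertRow r x with
    | (r', none) => r' :: rs
    | (r', some y) => r' :: insertTab rs y

/-- The Robinson–Schensted insertion tableau of a word. -/
def Ptab (w : List ℕ) : List (List ℕ) := w.foldl insertTab []

/-- The Young diagram with row lengths `r` (junk-robust version). -/
def diagramOfRows (r : List ℕ) : YoungDiagram :=
  ⟨(Finset.range r.length ×ˢ Finset.range (r.foldr max 0)).filter
      (fun p => ∀ i ≤ p.1, p.2 < r.getD i 0), by
    intro a b hab ha
    rw [Finset.mem_coe, Finset.mem_filter, Finset.mem_product] at ha ⊢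
    obtain ⟨⟨h1, h2⟩, h3⟩ := ha
    simp only [Finset.mem_range] at h1 h2 ⊢
    refine ⟨⟨lt_of_le_of_lt hab.1 h1, lt_of_le_of_lt hab.2 h2⟩, fun i hi => ?_⟩
    exact lt_of_le_of_lt hab.2 (h3 i (le_trans hi hab.1))⟩

/-- The shape of the Robinson–Schensted insertion tableau of a word. -/
def RSshape (w : List ℕ) : YoungDiagram := diagramOfRows ((Ptab w).map List.length)

/-- The one-line word of a permutation of `Fin a` (with values `0,…,a-1`). -/
def wordOf {a : ℕ} (σ : Equiv.Perm (Fin a)) : List ℕ :=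
  (List.finRange a).map fun i => (σ i : ℕ)

/-- The chain encoding of the Robinson–Schensted insertion tableau `P(σ)`:
its `i`-th diagram is the shape of the subtableau of `P(σ)` with entries `≤ i`,
which equals the RS-shape of the subword of `σ` with values `≤ i`. -/
def Pchain {a : ℕ} (σ : Equiv.Perm (Fin a)) : Fin (a + 1) → YoungDiagram :=
  fun i => RSshape ((wordOf σ).filter fun x => x < (i : ℕ))

/-- The chain encoding of the Robinson–Schensted recording tableau `Q(σ)`:
its `i`-th diagram is the shape of the subtableau of `Q(σ)` with entries `≤ i`,
which equals the RS-shape of the prefix of `σ` of length `i`. -/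
def Qchain {a : ℕ} (σ : Equiv.Perm (Fin a)) : Fin (a + 1) → YoungDiagram :=
  fun i => RSshape ((wordOf σ).take (i : ℕ))

/-! ### Row lengths of Young diagrams -/

theorem diagram_ext {μ ν : YoungDiagram} (h : ∀ i, μ.rowLen i = ν.rowLen i) : μ = ν := by
  apply YoungDiagram.ext
  ext ⟨i, j⟩
  rw [YoungDiagram.mem_cells, YoungDiagram.mem_cells, YoungDiagram.mem_iff_lt_rowLen,
    YoungDiagram.mem_iff_lt_rowLen, h]

theorem diagram_le_iff {μ ν : YoungDiagram} : μ ≤ ν ↔ ∀ i, μ.rowLen i ≤ ν.rowLen i := by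
  constructor
  · intro h i
    by_contra! hc
    have := h (YoungDiagram.mem_iff_lt_rowLen.2 hc)
    exact lt_irrefl _ (YoungDiagram.mem_iff_lt_rowLen.1 this)
  · rintro h ⟨i, j⟩ hx
    exact YoungDiagram.mem_iff_lt_rowLen.2 ((YoungDiagram.mem_iff_lt_rowLen.1 hx).trans_le (h i))

theorem rowLen_eq_zero {μ : YoungDiagram} {i : ℕ} (h : μ.card ≤ i) : μ.rowLen i = 0 := by
  by_contra hc
  have hsub : (range (i + 1)).image (fun k => (k, 0)) ⊆ μ.cells := by
    intro x hx
    obtain ⟨k, hk, rfl⟩ := mem_image.1 hx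
    rw [YoungDiagram.mem_cells]
    exact μ.up_left_mem (by simpa [Nat.lt_succ_iff] using hk) le_rfl
      (YoungDiagram.mem_iff_lt_rowLen.2 (Nat.pos_of_ne_zero hc))
  have := card_le_card hsub
  rw [card_image_of_injective _ (fun a b hab => by simpa using hab), card_range] at this
  exact absurd (this.trans h) (by omega)

theorem rowLen_le_card (μ : YoungDiagram) (i : ℕ) : μ.rowLen i ≤ μ.card := by
  rw [YoungDiagram.rowLen_eq_card]
  exact card_le_card (filter_subset _ _)

theorem card_eq_sum_rowLen (μ : YoungDiagram) {n : ℕ} (h : μ.card ≤ n) :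
    μ.card = ∑ i ∈ range n, μ.rowLen i := by
  have hm : ∀ x ∈ μ.cells, x.1 ∈ range n := by
    rintro ⟨i, j⟩ hx
    rw [YoungDiagram.mem_cells, YoungDiagram.mem_iff_lt_rowLen] at hx
    rw [mem_range]
    by_contra! hc
    rw [rowLen_eq_zero (h.trans hc)] at hx
    exact absurd hx (by omega)
  rw [YoungDiagram.card, card_eq_sum_card_fiberwise hm]
  exact sum_congr rfl fun i _ => (YoungDiagram.rowLen_eq_card μ).symm

theorem eq_of_le_of_card_eq {μ ν : YoungDiagram} (h : μ ≤ ν) (hc : μ.card = ν.card) : μ = ν :=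
  YoungDiagram.ext (eq_of_subset_of_card_le (YoungDiagram.cells_subset_iff.2 h) hc.ge)

theorem card_mono {μ ν : YoungDiagram} (h : μ ≤ ν) : μ.card ≤ ν.card :=
  card_le_card (YoungDiagram.cells_subset_iff.2 h)

theorem card_bot : (⊥ : YoungDiagram).card = 0 := by
  rw [YoungDiagram.card, YoungDiagram.cells_bot, card_empty]

theorem mem_subDiagrams {μ l : YoungDiagram} : μ ∈ subDiagrams l ↔ μ ≤ l := by
  classical
  rw [subDiagrams, mem_image]
  constructor
  · rintro ⟨⟨s, hs⟩, -, rfl⟩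
    rw [mem_filter, mem_powerset] at hs
    exact YoungDiagram.cells_subset_iff.1 hs.1
  · intro h
    exact ⟨⟨μ.cells, mem_filter.2 ⟨mem_powerset.2 (YoungDiagram.cells_subset_iff.2 h),
      μ.isLowerSet⟩⟩, mem_attach _ _, rfl⟩

theorem le_square {μ : YoungDiagram} {n : ℕ} (h : μ.card ≤ n) : μ ≤ square n := by
  rintro ⟨i, j⟩ hx
  have hj := YoungDiagram.mem_iff_lt_rowLen.1 hx
  change (i, j) ∈ range n ×ˢ range n
  rw [mem_product, mem_range, mem_range]
  refine ⟨?_, hj.trans_le ((rowLen_le_card μ i).trans h)⟩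
  by_contra! hc
  rw [rowLen_eq_zero (h.trans hc)] at hj
  exact absurd hj (by omega)

theorem mem_diagramsOfCard {μ : YoungDiagram} {k : ℕ} : μ ∈ diagramsOfCard k ↔ μ.card = k := by
  rw [diagramsOfCard, mem_filter, mem_subDiagrams]
  exact ⟨fun h => h.2, fun h => ⟨le_square h.le, h⟩⟩

/-- The Young diagram whose row lengths are `f`, for `f` antitone and vanishing from `n` on. -/
def ofRows (f : ℕ → ℕ) (n : ℕ) : YoungDiagram :=
  ⟨(range n ×ˢ range (f 0)).filter fun p => ∀ i ≤ p.1, p.2 < f i, by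
    intro a b hab ha
    rw [mem_coe, mem_filter, mem_product, mem_range, mem_range] at ha ⊢
    exact ⟨⟨hab.1.trans_lt ha.1.1, hab.2.trans_lt ha.1.2⟩,
      fun i hi => hab.2.trans_lt (ha.2 i (hi.trans hab.1))⟩⟩

theorem rowLen_ofRows {f : ℕ → ℕ} {n : ℕ} (hf : ∀ i, f (i + 1) ≤ f i) (hn : ∀ i, n ≤ i → f i = 0)
    (i : ℕ) : (ofRows f n).rowLen i = f i := by
  have hanti : Antitone f := antitone_nat_of_succ_le hf
  have key : ∀ j, j < (ofRows f n).rowLen i ↔ j < f i := by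
    intro j
    rw [← YoungDiagram.mem_iff_lt_rowLen, ofRows, ← YoungDiagram.mem_cells]
    simp only [mem_filter, mem_product, mem_range]
    constructor
    · exact fun h => h.2 i le_rfl
    · intro h
      refine ⟨⟨?_, h.trans_le (hanti (Nat.zero_le i))⟩, fun k hk => h.trans_le (hanti hk)⟩
      by_contra! hc
      rw [hn i hc] at h
      exact absurd h (by omega)
  have h1 := key (f i)
  have h2 := key ((ofRows f n).rowLen i)
  omega

/-! ### Horizontal strips -/

/-- `κ / ν` is a horizontal strip. -/
def HStrip (ν κ : YoungDiagram) : Prop :=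
  ∀ i, ν.rowLen i ≤ κ.rowLen i ∧ κ.rowLen (i + 1) ≤ ν.rowLen i

theorem HStrip.le {ν κ : YoungDiagram} (h : HStrip ν κ) : ν ≤ κ :=
  diagram_le_iff.2 fun i => (h i).1

theorem HStrip.refl (ν : YoungDiagram) : HStrip ν ν :=
  fun i => ⟨le_rfl, ν.rowLen_anti _ _ (Nat.le_succ i)⟩

-- The diagrams obtained from `ν` by adding a horizontal strip of size `k`.
open scoped Classical in
noncomputable def addStrip (k : ℕ) (ν : YoungDiagram) : Finset YoungDiagram :=
  (diagramsOfCard (ν.card + k)).filter fun κ => HStrip ν κ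

-- The diagrams obtained from `κ` by removing a horizontal strip of size `k`.
open scoped Classical in
noncomputable def removeStrip (k : ℕ) (κ : YoungDiagram) : Finset YoungDiagram :=
  (subDiagrams κ).filter fun ν => HStrip ν κ ∧ ν.card + k = κ.card

theorem mem_addStrip {k : ℕ} {ν κ : YoungDiagram} :
    κ ∈ addStrip k ν ↔ HStrip ν κ ∧ κ.card = ν.card + k := by
  classical
  rw [addStrip, mem_filter, mem_diagramsOfCard, and_comm]

theorem mem_removeStrip {k : ℕ} {ν κ : YoungDiagram} :
    ν ∈ removeStrip k κ ↔ HStrip ν κ ∧ ν.card + k = κ.card := by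
  classical
  rw [removeStrip, mem_filter, mem_subDiagrams]
  exact ⟨fun h => h.2, fun h => ⟨h.1.le, h⟩⟩

theorem addStrip_zero (ν : YoungDiagram) : addStrip 0 ν = {ν} := by
  ext κ
  rw [mem_addStrip, mem_singleton]
  constructor
  · rintro ⟨h, hc⟩
    exact (eq_of_le_of_card_eq h.le (by omega)).symm
  · rintro rfl
    exact ⟨HStrip.refl _, rfl⟩

theorem removeStrip_zero (κ : YoungDiagram) : removeStrip 0 κ = {κ} := by
  ext ν
  rw [mem_removeStrip, mem_singleton]
  constructor
  · rintro ⟨h, hc⟩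
    exact eq_of_le_of_card_eq h.le (by omega)
  · rintro rfl
    exact ⟨HStrip.refl _, rfl⟩

theorem removeStrip_bot {k : ℕ} (hk : k ≠ 0) : removeStrip k ⊥ = ∅ := by
  ext ν
  rw [mem_removeStrip]
  simp [card_bot, hk]

/-- Row-wise reflection turning a diagram below both `α` and `μ` into one above both. -/
def flipUp (α μ : YoungDiagram) (l : ℕ) (ν : YoungDiagram) : YoungDiagram :=
  ofRows (fun i => match i with
    | 0 => max (α.rowLen 0) (μ.rowLen 0) + l
    | i + 1 => max (α.rowLen (i + 1)) (μ.rowLen (i + 1)) +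
        min (α.rowLen i) (μ.rowLen i) - ν.rowLen i) (α.card + μ.card + 1)

/-- Row-wise reflection turning a diagram above both `α` and `μ` into one below both. -/
def flipDown (α μ κ : YoungDiagram) : YoungDiagram :=
  ofRows (fun i => max (α.rowLen (i + 1)) (μ.rowLen (i + 1)) +
    min (α.rowLen i) (μ.rowLen i) - κ.rowLen (i + 1)) (α.card + μ.card + 1)

theorem rowLen_flipUp {α μ ν : YoungDiagram} (hα : HStrip ν α) (hμ : HStrip ν μ) (l : ℕ) :
    (flipUp α μ l ν).rowLen 0 = max (α.rowLen 0) (μ.rowLen 0) + l ∧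
    ∀ i, (flipUp α μ l ν).rowLen (i + 1) = max (α.rowLen (i + 1)) (μ.rowLen (i + 1)) +
        min (α.rowLen i) (μ.rowLen i) - ν.rowLen i := by
  have key := rowLen_ofRows (f := fun i => match i with
    | 0 => max (α.rowLen 0) (μ.rowLen 0) + l
    | i + 1 => max (α.rowLen (i + 1)) (μ.rowLen (i + 1)) +
        min (α.rowLen i) (μ.rowLen i) - ν.rowLen i) (n := α.card + μ.card + 1) ?_ ?_
  · exact ⟨key 0, fun i => key (i + 1)⟩
  · rintro (_ | i)
    · have := hα 0; have := hμ 0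
      simp only
      omega
    · have := hα (i + 1); have := hμ (i + 1); have := hα i; have := hμ i
      simp only
      omega
  · rintro (_ | i) hi
    · omega
    · have h1 : α.rowLen i = 0 := rowLen_eq_zero (by omega)
      have h2 : μ.rowLen i = 0 := rowLen_eq_zero (by omega)
      have := hα i; have := hμ i
      have := α.rowLen_anti _ _ (Nat.le_succ i); have := μ.rowLen_anti _ _ (Nat.le_succ i)
      simp only [Nat.succ_eq_add_one] at *
      omega

theorem rowLen_flipDown {α μ κ : YoungDiagram} (hα : HStrip α κ) (hμ : HStrip μ κ) (i : ℕ) :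
    (flipDown α μ κ).rowLen i = max (α.rowLen (i + 1)) (μ.rowLen (i + 1)) +
      min (α.rowLen i) (μ.rowLen i) - κ.rowLen (i + 1) := by
  refine rowLen_ofRows (fun i => ?_) (fun i hi => ?_) i
  · have := hα (i + 1 + 1); have := hμ (i + 1 + 1); have := hα (i + 1); have := hμ (i + 1); have := hα i; have := hμ i
    omega
  · have h1 : α.rowLen i = 0 := rowLen_eq_zero (by omega)
    have h2 : μ.rowLen i = 0 := rowLen_eq_zero (by omega)
    have := α.rowLen_anti _ _ (Nat.le_succ i); have := μ.rowLen_anti _ _ (Nat.le_succ i)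
    simp only [Nat.succ_eq_add_one] at *
    omega

theorem card_add_card_of_reflect {α μ ν κ : YoungDiagram} {l : ℕ}
    (h0 : κ.rowLen 0 = max (α.rowLen 0) (μ.rowLen 0) + l)
    (h : ∀ i, κ.rowLen (i + 1) + ν.rowLen i =
      max (α.rowLen (i + 1)) (μ.rowLen (i + 1)) + min (α.rowLen i) (μ.rowLen i)) :
    κ.card + ν.card = α.card + μ.card + l := by
  obtain ⟨n, hn⟩ : ∃ n, n = α.card + μ.card + ν.card + κ.card := ⟨_, rfl⟩
  rw [card_eq_sum_rowLen κ (n := n + 1) (by omega), card_eq_sum_rowLen ν (n := n) (by omega),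
    card_eq_sum_rowLen α (n := n) (by omega), card_eq_sum_rowLen μ (n := n) (by omega),
    sum_range_succ', h0]
  have h1 := sum_congr rfl fun i (_ : i ∈ range n) => h i
  rw [sum_add_distrib, sum_add_distrib] at h1
  have h2 := sum_range_succ' (fun i => max (α.rowLen i) (μ.rowLen i)) n
  rw [sum_range_succ, rowLen_eq_zero (show α.card ≤ n by omega),
    rowLen_eq_zero (show μ.card ≤ n by omega)] at h2
  have h3 := sum_congr rfl fun i (_ : i ∈ range n) => max_add_min (α.rowLen i) (μ.rowLen i)
  rw [sum_add_distrib, sum_add_distrib] at h3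
  simp only [max_self] at h2
  omega

theorem flipUp_strip {α μ ν : YoungDiagram} (hα : HStrip ν α) (hμ : HStrip ν μ) (l : ℕ) :
    HStrip α (flipUp α μ l ν) ∧ HStrip μ (flipUp α μ l ν) ∧
      (flipUp α μ l ν).card + ν.card = α.card + μ.card + l := by
  obtain ⟨h0, h⟩ := rowLen_flipUp hα hμ l
  refine ⟨fun i => ?_, fun i => ?_, card_add_card_of_reflect h0 fun i => ?_⟩
  · have := hα i; have := hμ i; have := h i
    rcases i with _ | i
    · omega
    · have := hα (i + 1); have := hμ (i + 1); have := h i; have := hα i; have := hμ i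
      omega
  · have := hα i; have := hμ i; have := h i
    rcases i with _ | i
    · omega
    · have := hα (i + 1); have := hμ (i + 1); have := h i; have := hα i; have := hμ i
      omega
  · have := hα i; have := hμ i; have := h i
    omega

theorem flipDown_strip {α μ κ : YoungDiagram} (hα : HStrip α κ) (hμ : HStrip μ κ) :
    HStrip (flipDown α μ κ) α ∧ HStrip (flipDown α μ κ) μ ∧
      κ.card + (flipDown α μ κ).card + max (α.rowLen 0) (μ.rowLen 0) =
        α.card + μ.card + κ.rowLen 0 := by
  have h := rowLen_flipDown hα hμ
  refine ⟨fun i => ?_, fun i => ?_, ?_⟩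
  · have := hα i; have := hμ i; have := h i; have := hα (i + 1); have := hμ (i + 1)
    omega
  · have := hα i; have := hμ i; have := h i; have := hα (i + 1); have := hμ (i + 1)
    omega
  · have := hα 0; have := hμ 0
    have := card_add_card_of_reflect (α := α) (μ := μ) (ν := flipDown α μ κ) (κ := κ)
      (l := κ.rowLen 0 - max (α.rowLen 0) (μ.rowLen 0)) (by omega) (fun i => by
        have := hα i; have := hμ i; have := h i; have := hα (i + 1); have := hμ (i + 1)
        omega)
    omega

theorem flipUp_flipDown {α μ κ : YoungDiagram} (hα : HStrip α κ) (hμ : HStrip μ κ) :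
    flipUp α μ (κ.rowLen 0 - max (α.rowLen 0) (μ.rowLen 0)) (flipDown α μ κ) = κ := by
  obtain ⟨h1, h2, -⟩ := flipDown_strip hα hμ
  obtain ⟨h0, h⟩ := rowLen_flipUp h1 h2 (κ.rowLen 0 - max (α.rowLen 0) (μ.rowLen 0))
  refine diagram_ext fun i => ?_
  rcases i with _ | i
  · have := hα 0; have := hμ 0
    omega
  · have := h i; have := rowLen_flipDown hα hμ i
    have := hα i; have := hμ i; have := hα (i + 1); have := hμ (i + 1)
    omega

theorem flipDown_flipUp {α μ ν : YoungDiagram} (hα : HStrip ν α) (hμ : HStrip ν μ) (l : ℕ) :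
    flipDown α μ (flipUp α μ l ν) = ν := by
  obtain ⟨h1, h2, -⟩ := flipUp_strip hα hμ l
  obtain ⟨h0, h⟩ := rowLen_flipUp hα hμ l
  refine diagram_ext fun i => ?_
  have := h i; have := rowLen_flipDown h1 h2 i
  have := hα i; have := hμ i
  omega

/-- Commutation of adding and removing horizontal strips. -/
theorem sum_addStrip_removeStrip (a b : ℕ) (α : YoungDiagram) (g : YoungDiagram → ℝ) :
    ∑ κ ∈ addStrip a α, ∑ μ ∈ removeStrip b κ, g μ =
      ∑ l ∈ range (min a b + 1), ∑ ν ∈ removeStrip (b - l) α, ∑ μ ∈ addStrip (a - l) ν, g μ := by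
  simp only [sum_sigma']
  refine sum_bij'
    (fun x _ => ⟨x.1.rowLen 0 - max (α.rowLen 0) (x.2.rowLen 0), flipDown α x.2 x.1, x.2⟩)
    (fun y _ => ⟨flipUp α y.2.2 y.1 y.2.1, y.2.2⟩) ?_ ?_ ?_ ?_ ?_
  · rintro ⟨κ, μ⟩ h
    simp only [mem_sigma, mem_addStrip, mem_removeStrip, mem_range] at h ⊢
    obtain ⟨h1, h2, h3⟩ := flipDown_strip h.1.1 h.2.1
    have h4 := card_mono h1.le
    have h5 := card_mono h2.le
    have := h.1.1 0; have := h.2.1 0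
    refine ⟨by omega, ⟨h1, by omega⟩, h2, by omega⟩
  · rintro ⟨l, ν, μ⟩ h
    simp only [mem_sigma, mem_addStrip, mem_removeStrip, mem_range] at h ⊢
    obtain ⟨h1, h2, h3⟩ := flipUp_strip h.2.1.1 h.2.2.1 l
    refine ⟨⟨h1, by omega⟩, h2, by omega⟩
  · rintro ⟨κ, μ⟩ h
    simp only [mem_sigma, mem_addStrip, mem_removeStrip] at h
    simp only [flipUp_flipDown h.1.1 h.2.1]
  · rintro ⟨l, ν, μ⟩ h
    simp only [mem_sigma, mem_addStrip, mem_removeStrip] at h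
    simp only [flipDown_flipUp h.2.1.1 h.2.2.1, (rowLen_flipUp h.2.1.1 h.2.2.1 l).1,
      Nat.add_sub_cancel_left]
  · rintro ⟨κ, μ⟩ h
    rfl

theorem card_addStrip (k : ℕ) (α : YoungDiagram) :
    (addStrip k α).card = ∑ i ∈ range (k + 1), (removeStrip i α).card := by
  rw [← card_sigma]
  refine card_bij'
    (fun κ _ => ⟨α.card - (flipDown α α κ).card, flipDown α α κ⟩)
    (fun y _ => flipUp α α (k - y.1) y.2) ?_ ?_ ?_ ?_
  · intro κ h
    simp only [mem_sigma, mem_addStrip, mem_removeStrip, mem_range] at h ⊢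
    obtain ⟨h1, h2, h3⟩ := flipDown_strip h.1 h.1
    have h4 := card_mono h1.le
    have := h.1 0
    rw [max_self] at h3
    refine ⟨by omega, h1, by omega⟩
  · rintro ⟨i, ν⟩ h
    simp only [mem_sigma, mem_addStrip, mem_removeStrip, mem_range] at h ⊢
    obtain ⟨h1, h2, h3⟩ := flipUp_strip h.2.1 h.2.1 (k - i)
    refine ⟨h1, by omega⟩
  · intro κ h
    rw [mem_addStrip] at h
    obtain ⟨h1, h2, h3⟩ := flipDown_strip h.1 h.1
    have h4 := card_mono h1.le
    have h5 := flipUp_flipDown h.1 h.1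
    have := h.1 0
    rw [max_self] at h3 h5
    convert h5 using 2
    simp only
    omega
  · rintro ⟨i, ν⟩ h
    simp only [mem_sigma, mem_removeStrip, mem_range] at h
    simp only [flipDown_flipUp h.2.1 h.2.1]
    congr 1
    omega

/-! ### The lowest row of a skew shape -/

/-- The lowest row in which `κ` and `ν` differ. -/
def stepRow (ν κ : YoungDiagram) : ℕ := (κ.cells \ ν.cells).sup Prod.fst

theorem mem_cells_sdiff {ν κ : YoungDiagram} {i j : ℕ} :
    (i, j) ∈ κ.cells \ ν.cells ↔ ν.rowLen i ≤ j ∧ j < κ.rowLen i := by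
  rw [mem_sdiff, YoungDiagram.mem_cells, YoungDiagram.mem_cells, YoungDiagram.mem_iff_lt_rowLen,
    YoungDiagram.mem_iff_lt_rowLen, not_lt, and_comm]

theorem stepRow_le_iff {ν κ : YoungDiagram} (h : ν ≤ κ) {r : ℕ} :
    stepRow ν κ ≤ r ↔ ∀ i, r < i → κ.rowLen i = ν.rowLen i := by
  rw [stepRow, Finset.sup_le_iff]
  constructor
  · intro hs i hi
    refine le_antisymm ?_ (diagram_le_iff.1 h i)
    by_contra! hc
    exact absurd (hs (i, ν.rowLen i) (mem_cells_sdiff.2 ⟨le_rfl, hc⟩)) (not_le.2 hi)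
  · rintro hs ⟨i, j⟩ hij
    rw [mem_cells_sdiff] at hij
    by_contra! hc
    have := hs i hc
    omega

theorem rowLen_lt_of_stepRow {ν κ : YoungDiagram} (hc : ν.card < κ.card) :
    ν.rowLen (stepRow ν κ) < κ.rowLen (stepRow ν κ) := by
  have hne : (κ.cells \ ν.cells).Nonempty := by
    rw [nonempty_iff_ne_empty, Ne, sdiff_eq_empty_iff_subset]
    exact fun h => absurd (card_le_card h) (not_le.2 hc)
  obtain ⟨⟨i, j⟩, hx, he⟩ := exists_mem_eq_sup _ hne Prod.fst
  rw [stepRow, he]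
  rw [mem_cells_sdiff] at hx
  exact hx.1.trans_lt hx.2

theorem rowLen_of_cover {ν κ : YoungDiagram} (h : ν ≤ κ) (hc : κ.card = ν.card + 1) (i : ℕ) :
    κ.rowLen i = ν.rowLen i + if i = stepRow ν κ then 1 else 0 := by
  have h1 : (κ.cells \ ν.cells).card = 1 := by
    rw [card_sdiff_of_subset (YoungDiagram.cells_subset_iff.2 h)]
    have : κ.cells.card = ν.cells.card + 1 := hc
    omega
  obtain ⟨⟨r, c⟩, he⟩ := card_eq_one.1 h1
  have hr : stepRow ν κ = r := by rw [stepRow, he, sup_singleton]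
  have hm : ∀ i j, ν.rowLen i ≤ j ∧ j < κ.rowLen i ↔ i = r ∧ j = c := by
    intro i j
    rw [← mem_cells_sdiff, he, mem_singleton, Prod.mk.injEq]
  have hle := diagram_le_iff.1 h i
  rw [hr]
  have h2 := hm i (ν.rowLen i)
  have h3 := hm i (ν.rowLen i + 1)
  have h4 := (hm r c).2 ⟨rfl, rfl⟩
  by_cases hi : i = r
  · subst hi
    simp only [true_and] at h2 h3
    rw [if_pos rfl]
    omega
  · simp only [hi, false_and, iff_false] at h2
    rw [if_neg hi]
    omega

theorem mem_addStrip_one {ν κ : YoungDiagram} :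
    κ ∈ addStrip 1 ν ↔ ν ≤ κ ∧ κ.card = ν.card + 1 := by
  rw [mem_addStrip]
  refine ⟨fun h => ⟨h.1.le, h.2⟩, fun h => ⟨fun i => ⟨diagram_le_iff.1 h.1 i, ?_⟩, h.2⟩⟩
  have h1 := rowLen_of_cover h.1 h.2 i
  have h2 := rowLen_of_cover h.1 h.2 (i + 1)
  have := ν.rowLen_anti _ _ (Nat.le_succ i)
  have := κ.rowLen_anti _ _ (Nat.le_succ i)
  simp only [Nat.succ_eq_add_one] at *
  split_ifs at h1 h2 <;> omega

-- The horizontal strips of size `k` added to `ν` in the rows `0, …, r`.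
open scoped Classical in
noncomputable def addStripLe (k r : ℕ) (ν : YoungDiagram) : Finset YoungDiagram :=
  (addStrip k ν).filter fun κ => ∀ i, r < i → κ.rowLen i = ν.rowLen i

theorem mem_addStripLe {k r : ℕ} {ν κ : YoungDiagram} :
    κ ∈ addStripLe k r ν ↔
      HStrip ν κ ∧ κ.card = ν.card + k ∧ ∀ i, r < i → κ.rowLen i = ν.rowLen i := by
  classical
  rw [addStripLe, mem_filter, mem_addStrip, and_assoc]

theorem exists_addCell {ν κ : YoungDiagram} (h : HStrip ν κ) {r : ℕ}
    (hr : ν.rowLen r < κ.rowLen r) : ∃ ν' : YoungDiagram,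
      (∀ i, ν'.rowLen i = ν.rowLen i + if i = r then 1 else 0) ∧ ν'.card = ν.card + 1 := by
  have key := rowLen_ofRows (f := fun i => ν.rowLen i + if i = r then 1 else 0)
    (n := ν.card + r + 1) ?_ ?_
  · refine ⟨_, key, ?_⟩
    set ν' := ofRows (fun i => ν.rowLen i + if i = r then 1 else 0) (ν.card + r + 1)
    obtain ⟨n, hn⟩ : ∃ n, n = ν'.card + ν.card + r + 1 := ⟨_, rfl⟩
    rw [card_eq_sum_rowLen ν' (n := n) (by omega), card_eq_sum_rowLen ν (n := n) (by omega),
      sum_congr rfl fun i _ => key i, sum_add_distrib, sum_ite_eq', if_pos]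
    rw [mem_range]
    omega
  · intro i
    have := h i
    have := ν.rowLen_anti _ _ (Nat.le_succ i)
    simp only [Nat.succ_eq_add_one] at *
    by_cases hi : i + 1 = r
    · subst hi
      simp
      omega
    · rw [if_neg hi]
      omega
  · intro i hi
    have := rowLen_eq_zero (μ := ν) (i := i) (by omega)
    rw [this, if_neg (by omega)]

theorem stepRow_eq_of_mem {ν ν' κ : YoungDiagram} {k : ℕ} (h1 : ν' ∈ addStrip 1 ν)
    (h2 : κ ∈ addStripLe k (stepRow ν ν') ν') : stepRow ν κ = stepRow ν ν' := by
  rw [mem_addStrip_one] at h1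
  rw [mem_addStripLe] at h2
  have hle := h1.1.trans h2.1.le
  apply le_antisymm
  · rw [stepRow_le_iff hle]
    intro i hi
    rw [h2.2.2 i hi, (stepRow_le_iff h1.1).1 le_rfl i hi]
  · rw [stepRow_le_iff h1.1]
    intro i hi
    have := (stepRow_le_iff hle).1 le_rfl i hi
    have := diagram_le_iff.1 h1.1 i
    have := diagram_le_iff.1 h2.1.le i
    omega

/-- A horizontal strip is built by adding its lowest, leftmost cell first. -/
theorem sum_addStrip_one_addStripLe (k : ℕ) (ν : YoungDiagram) (F : ℕ → YoungDiagram → ℝ) :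
    ∑ ν' ∈ addStrip 1 ν, ∑ κ ∈ addStripLe k (stepRow ν ν') ν', F (stepRow ν ν') κ =
      ∑ κ ∈ addStrip (k + 1) ν, F (stepRow ν κ) κ := by
  rw [sum_sigma']
  refine sum_bij (fun x _ => x.2) ?_ ?_ ?_ ?_
  · rintro ⟨ν', κ⟩ h
    rw [mem_sigma] at h
    have h1 := mem_addStrip_one.1 h.1
    have h2 := mem_addStripLe.1 h.2
    simp only at h1 h2 ⊢
    refine mem_addStrip.2 ⟨fun i => ?_, by omega⟩
    have h3 := rowLen_of_cover h1.1 h1.2 i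
    have h4 := h2.1 i
    have h5 := ν'.rowLen_anti _ _ (Nat.le_succ i)
    have h6 := rowLen_of_cover h1.1 h1.2 (i + 1)
    have h7 := ν.rowLen_anti _ _ (Nat.le_succ i)
    by_cases hi : i = stepRow ν ν'
    · have h8 := h2.2.2 (i + 1) (by omega)
      rw [if_neg (by omega)] at h6
      simp only [Nat.succ_eq_add_one] at *
      omega
    · rw [if_neg hi] at h3
      omega
  · rintro ⟨ν', κ⟩ h ⟨ν'', κ'⟩ h' he
    simp only at he
    subst he
    rw [mem_sigma] at h h'
    have e1 := stepRow_eq_of_mem h.1 h.2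
    have e2 := stepRow_eq_of_mem h'.1 h'.2
    have h1 := mem_addStrip_one.1 h.1
    have h1' := mem_addStrip_one.1 h'.1
    simp only at *
    have : ν' = ν'' := by
      refine diagram_ext fun i => ?_
      rw [rowLen_of_cover h1.1 h1.2 i, rowLen_of_cover h1'.1 h1'.2 i, ← e1, ← e2]
    rw [this]
  · intro κ h
    rw [mem_addStrip] at h
    have hlt := rowLen_lt_of_stepRow (show ν.card < κ.card by omega)
    obtain ⟨ν', h1, h2⟩ := exists_addCell h.1 hlt
    have hle : ν ≤ ν' := diagram_le_iff.2 fun i => by rw [h1]; omega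
    have hrow : stepRow ν ν' = stepRow ν κ := by
      have := h1 (stepRow ν κ)
      rw [rowLen_of_cover hle h2, if_pos rfl] at this
      by_contra hc
      rw [if_neg (Ne.symm hc)] at this
      omega
    refine ⟨⟨ν', κ⟩, mem_sigma.2 ⟨mem_addStrip_one.2 ⟨hle, h2⟩,
      mem_addStripLe.2 ⟨fun i => ?_, by simp only; omega, ?_⟩⟩, rfl⟩
    · have := h.1 i
      have := h1 i
      by_cases hi : i = stepRow ν κ
      · rw [if_pos hi] at this
        rw [← hi] at hlt
        simp only
        omega
      · rw [if_neg hi] at this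
        simp only
        omega
    · intro i hi
      simp only at hi ⊢
      rw [hrow] at hi
      rw [h1, if_neg (by omega), (stepRow_le_iff h.1.le).1 le_rfl i hi, add_zero]
  · rintro ⟨ν', κ⟩ h
    rw [mem_sigma] at h
    simp only
    rw [stepRow_eq_of_mem h.1 h.2]

/-! ### Strip operators and weighted chains -/

/-- Linear endomorphisms of the space of functions on Young diagrams. -/
abbrev DiagramEnd : Type := Module.End ℝ (YoungDiagram → ℝ)

/-- Sum over all ways of adding a horizontal strip of size `k`. -/
noncomputable def upOp (k : ℕ) : DiagramEnd where
  toFun g α := ∑ κ ∈ addStrip k α, g κ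
  map_add' g h := by
    ext α
    simp [sum_add_distrib]
  map_smul' c g := by
    ext α
    simp [mul_sum]

/-- Sum over all ways of removing a horizontal strip of size `k`. -/
noncomputable def downOp (k : ℕ) : DiagramEnd where
  toFun g α := ∑ κ ∈ removeStrip k α, g κ
  map_add' g h := by
    ext α
    simp [sum_add_distrib]
  map_smul' c g := by
    ext α
    simp [mul_sum]

theorem upOp_apply (k : ℕ) (g : YoungDiagram → ℝ) (α : YoungDiagram) :
    upOp k g α = ∑ κ ∈ addStrip k α, g κ := rfl

theorem downOp_apply (k : ℕ) (g : YoungDiagram → ℝ) (α : YoungDiagram) :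
    downOp k g α = ∑ κ ∈ removeStrip k α, g κ := rfl

theorem upOp_zero : upOp 0 = 1 := by
  ext g α
  rw [upOp_apply, addStrip_zero, sum_singleton, Module.End.one_apply]

theorem downOp_zero : downOp 0 = 1 := by
  ext g α
  rw [downOp_apply, removeStrip_zero, sum_singleton, Module.End.one_apply]

theorem upOp_mul_downOp (a b : ℕ) :
    upOp a * downOp b = ∑ l ∈ range (min a b + 1), downOp (b - l) * upOp (a - l) := by
  ext g α
  rw [Module.End.mul_apply, LinearMap.sum_apply, Finset.sum_apply]
  exact sum_addStrip_removeStrip a b α g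

/-- One step of the transfer matrix for the major index: add a cell, the weight being `q ^ N`
if the row of the new cell is lower than the row recorded in the state. -/
noncomputable def stepOp (q : ℝ) (N : ℕ) :
    (YoungDiagram × ℕ → ℝ) →ₗ[ℝ] (YoungDiagram × ℕ → ℝ) where
  toFun h x := ∑ κ ∈ addStrip 1 x.1,
    (if x.2 < stepRow x.1 κ then q ^ N else 1) * h (κ, stepRow x.1 κ)
  map_add' g h := by
    ext x
    simp [mul_add, sum_add_distrib]
  map_smul' c g := by
    ext x
    simp [mul_sum, mul_left_comm]

/-- Sum over all chains of length `N`, weighted by `q ^ maj`. -/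
noncomputable def walkOp (q : ℝ) : ℕ → (YoungDiagram × ℕ → ℝ) →ₗ[ℝ] (YoungDiagram → ℝ)
  | 0 => LinearMap.funLeft ℝ ℝ fun α => (α, 0)
  | N + 1 => walkOp q N ∘ₗ stepOp q N

/-- Sum over all ways of adding a horizontal strip of size `k` not below the recorded row. -/
noncomputable def stripOp (k : ℕ) : (YoungDiagram → ℝ) →ₗ[ℝ] (YoungDiagram × ℕ → ℝ) where
  toFun g x := ∑ κ ∈ addStripLe k x.2 x.1, g κ
  map_add' g h := by
    ext x
    simp [sum_add_distrib]
  map_smul' c g := by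
    ext x
    simp [mul_sum]

theorem stripOp_zero_apply (g : YoungDiagram → ℝ) (x : YoungDiagram × ℕ) :
    stripOp 0 g x = g x.1 := by
  have : addStripLe 0 x.2 x.1 = {x.1} := by
    classical
    rw [addStripLe, addStrip_zero, filter_singleton, if_pos fun _ _ => rfl]
  change ∑ κ ∈ addStripLe 0 x.2 x.1, g κ = _
  rw [this, sum_singleton]

/-- Sum over all chains of length `N`, weighted by `q ^ maj`, as an endomorphism. -/
noncomputable def majOp (q : ℝ) (N : ℕ) : DiagramEnd := walkOp q N ∘ₗ stripOp 0

theorem majOp_zero (q : ℝ) : majOp q 0 = 1 := by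
  ext g α
  exact stripOp_zero_apply g (α, 0)

theorem stepOp_comp_stripOp (q : ℝ) (N k : ℕ) :
    stepOp q N ∘ₗ stripOp k =
      q ^ N • (stripOp 0 ∘ₗ upOp (k + 1)) + (1 - q ^ N) • stripOp (k + 1) := by
  classical
  ext g x
  obtain ⟨ν, r⟩ := x
  simp only [LinearMap.comp_apply, LinearMap.add_apply, LinearMap.smul_apply, Pi.add_apply,
    Pi.smul_apply, smul_eq_mul, stripOp_zero_apply, upOp_apply]
  change ∑ ν' ∈ addStrip 1 ν, (if r < stepRow ν ν' then q ^ N else 1) *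
    (∑ κ ∈ addStripLe k (stepRow ν ν') ν', g κ) = _ + _ * ∑ κ ∈ addStripLe (k + 1) r ν, g κ
  simp only [mul_sum]
  rw [sum_addStrip_one_addStripLe k ν fun s κ => (if r < s then q ^ N else 1) * g κ,
    addStripLe, sum_filter, ← sum_add_distrib]
  refine sum_congr rfl fun κ hκ => ?_
  have h := stepRow_le_iff (mem_addStrip.1 hκ).1.le (r := r)
  by_cases hc : stepRow ν κ ≤ r
  · rw [if_neg (not_lt.2 hc), if_pos (h.1 hc)]
    ring
  · rw [if_pos (not_le.1 hc), if_neg (fun hh => hc (h.2 hh))]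
    ring

theorem walkOp_succ_comp_stripOp (q : ℝ) (N k : ℕ) :
    walkOp q (N + 1) ∘ₗ stripOp k =
      q ^ N • (majOp q N * upOp (k + 1)) + (1 - q ^ N) • (walkOp q N ∘ₗ stripOp (k + 1)) := by
  rw [walkOp, LinearMap.comp_assoc, stepOp_comp_stripOp, LinearMap.comp_add, LinearMap.comp_smul,
    LinearMap.comp_smul]
  rfl

/-! ### Chains as sequences -/

/-- The sequence of diagrams of a chain, eventually constant. -/
def seqOf {n : ℕ} (c : Fin (n + 1) → YoungDiagram) (i : ℕ) : YoungDiagram :=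
  c ⟨min i n, by omega⟩

theorem seqOf_of_le {n : ℕ} (c : Fin (n + 1) → YoungDiagram) {i : ℕ} (h : i ≤ n) :
    seqOf c i = c ⟨i, by omega⟩ := by
  rw [seqOf]
  congr 2
  omega

theorem isSYTChain_iff {n : ℕ} {c : Fin (n + 1) → YoungDiagram} :
    IsSYTChain c ↔ ∀ i < n, seqOf c (i + 1) ∈ addStrip 1 (seqOf c i) := by
  refine forall₂_congr fun i hi => ?_
  rw [mem_addStrip_one, seqOf_of_le c hi.le, seqOf_of_le c (Nat.succ_le_of_lt hi)]

/-- The major index of a sequence of diagrams, using the first `N` steps. -/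
def majSeq (N : ℕ) (d : ℕ → YoungDiagram) : ℕ :=
  ∑ i ∈ range N,
    if i + 1 < N ∧ stepRow (d i) (d (i + 1)) < stepRow (d (i + 1)) (d (i + 2)) then i + 1 else 0

/-- The row of the cell added in the last of the first `N` steps. -/
def lastRow (d : ℕ → YoungDiagram) : ℕ → ℕ
  | 0 => 0
  | N + 1 => stepRow (d N) (d (N + 1))

theorem majSeq_succ (N : ℕ) (d : ℕ → YoungDiagram) :
    majSeq (N + 1) d =
      majSeq N d + if lastRow d N < stepRow (d N) (d (N + 1)) then N else 0 := by
  rcases N with _ | K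
  · simp [majSeq]
  · rw [majSeq, majSeq, sum_range_succ, sum_range_succ, sum_range_succ, lastRow]
    simp only [lt_irrefl, false_and, if_false, add_zero, Nat.lt_succ_self, true_and]
    congr 1
    refine sum_congr rfl fun i hi => ?_
    rw [mem_range] at hi
    simp only [show i + 1 < K + 1 + 1 by omega, show i + 1 < K + 1 by omega]

theorem majSeq_congr {N : ℕ} {d e : ℕ → YoungDiagram} (h : ∀ i ≤ N, d i = e i) :
    majSeq N d = majSeq N e := by
  refine sum_congr rfl fun i hi => ?_
  rw [mem_range] at hi
  by_cases hc : i + 1 < N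
  · rw [h i (by omega), h (i + 1) (by omega), h (i + 2) (by omega)]
  · simp [hc]

theorem lastRow_congr {N : ℕ} {d e : ℕ → YoungDiagram} (h : ∀ i ≤ N, d i = e i) :
    lastRow d N = lastRow e N := by
  rcases N with _ | K
  · rfl
  · rw [lastRow, lastRow, h K (by omega), h (K + 1) le_rfl]

theorem chainMaj_eq_majSeq {n : ℕ} (c : Fin (n + 1) → YoungDiagram) :
    chainMaj c = majSeq n (seqOf c) := by
  refine sum_congr rfl fun i hi => ?_
  rw [mem_range] at hi
  by_cases hc : i + 1 < n
  · rw [rowOfStep, dif_pos hi, rowOfStep, dif_pos hc, seqOf_of_le c (i := i) (by omega),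
      seqOf_of_le c (i := i + 1) (by omega), seqOf_of_le c (i := i + 2) (by omega)]
    rfl
  · simp [hc]

theorem seqOf_tailChain {n : ℕ} (c : Fin (n + 1) → YoungDiagram) (m i : ℕ) :
    seqOf (tailChain c m) i = seqOf c (m + i) := by
  rw [seqOf, seqOf, tailChain]
  congr 2
  simp only
  omega

-- Chains of length `n` starting at `μ`.
open scoped Classical in
noncomputable def chainsFrom (μ : YoungDiagram) (n : ℕ) : Finset (Fin (n + 1) → YoungDiagram) :=
  (Fintype.piFinset fun _ : Fin (n + 1) => subDiagrams (square (μ.card + n))).filter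
    fun c => seqOf c 0 = μ ∧ IsSYTChain c

theorem card_seqOf {n : ℕ} {c : Fin (n + 1) → YoungDiagram} (hc : IsSYTChain c) {i : ℕ}
    (hi : i ≤ n) : (seqOf c i).card = (seqOf c 0).card + i := by
  rw [isSYTChain_iff] at hc
  induction i with
  | zero => rfl
  | succ i ih =>
    have := ih (by omega)
    have := (mem_addStrip_one.1 (hc i hi)).2
    omega

theorem seqOf_mono {n : ℕ} {c : Fin (n + 1) → YoungDiagram} (hc : IsSYTChain c) :
    Monotone (seqOf c) := by
  refine monotone_nat_of_le_succ fun i => ?_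
  by_cases hi : i < n
  · exact (mem_addStrip_one.1 (isSYTChain_iff.1 hc i hi)).1
  · apply le_of_eq
    rw [seqOf, seqOf]
    congr 2
    omega

theorem mem_chainsFrom {μ : YoungDiagram} {n : ℕ} {c : Fin (n + 1) → YoungDiagram} :
    c ∈ chainsFrom μ n ↔ seqOf c 0 = μ ∧ IsSYTChain c := by
  classical
  rw [chainsFrom, mem_filter, Fintype.mem_piFinset]
  refine ⟨fun h => h.2, fun h => ⟨fun i => ?_, h⟩⟩
  have hi : (i : ℕ) ≤ n := by omega
  have := card_seqOf h.2 hi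
  rw [seqOf_of_le c hi, h.1] at this
  change (c i).card = _ at this
  rw [mem_subDiagrams]
  exact le_square (by omega)

theorem allSYT_eq (n : ℕ) : allSYT n = chainsFrom ⊥ n := by
  classical
  ext c
  rw [mem_chainsFrom, allSYT, mem_filter, Fintype.mem_piFinset, seqOf_of_le c (Nat.zero_le n)]
  refine ⟨fun h => h.2, fun h => ⟨fun i => ?_, h⟩⟩
  have hi : (i : ℕ) ≤ n := by omega
  have h0 := card_seqOf h.2 hi
  rw [seqOf_of_le c hi, seqOf_of_le c (Nat.zero_le n), h.1, card_bot] at h0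
  change (c i).card = _ at h0
  rw [mem_subDiagrams]
  exact le_square (by omega)

theorem mem_skewSYT {μ α : YoungDiagram} {n : ℕ} {c : Fin (n + 1) → YoungDiagram} :
    c ∈ skewSYT μ α n ↔ c ∈ chainsFrom μ n ∧ seqOf c n = α := by
  classical
  rw [mem_chainsFrom, skewSYT, mem_filter, Fintype.mem_piFinset, seqOf_of_le c (Nat.zero_le n),
    seqOf_of_le c le_rfl]
  refine ⟨fun h => ⟨⟨h.2.1, h.2.2.2⟩, h.2.2.1⟩, fun h => ⟨fun i => ?_, h.1.1, h.2, h.1.2⟩⟩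
  rw [mem_subDiagrams, ← h.2, ← seqOf_of_le c le_rfl]
  have := seqOf_mono h.1.2 (show (i : ℕ) ≤ n by omega)
  rwa [seqOf_of_le c (show (i : ℕ) ≤ n by omega)] at this

/-- Extend a chain by one diagram. -/
def snocChain {n : ℕ} (c : Fin (n + 1) → YoungDiagram) (κ : YoungDiagram) :
    Fin (n + 1 + 1) → YoungDiagram :=
  fun i => if (i : ℕ) ≤ n then seqOf c i else κ

theorem seqOf_snocChain {n : ℕ} (c : Fin (n + 1) → YoungDiagram) (κ : YoungDiagram) (i : ℕ) :
    seqOf (snocChain c κ) i = if i ≤ n then seqOf c i else κ := by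
  rw [seqOf, snocChain]
  simp only
  by_cases h : i ≤ n
  · rw [if_pos (by omega), if_pos h, min_eq_left (by omega)]
  · rw [if_neg (by omega), if_neg h]

theorem sum_chainsFrom_succ (μ : YoungDiagram) (n : ℕ)
    (f : (Fin (n + 1 + 1) → YoungDiagram) → ℝ) :
    ∑ c ∈ chainsFrom μ (n + 1), f c =
      ∑ c ∈ chainsFrom μ n, ∑ κ ∈ addStrip 1 (seqOf c n), f (snocChain c κ) := by
  rw [sum_sigma']
  have hinit : ∀ (c : Fin (n + 1 + 1) → YoungDiagram) (i : ℕ), i ≤ n →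
      seqOf (fun j : Fin (n + 1) => c j.castSucc) i = seqOf c i := by
    intro c i hi
    rw [seqOf_of_le _ hi, seqOf_of_le _ (show i ≤ n + 1 by omega)]
    rfl
  refine sum_bij' (fun c _ => ⟨fun j => c j.castSucc, seqOf c (n + 1)⟩)
    (fun x _ => snocChain x.1 x.2) ?_ ?_ ?_ ?_ ?_
  · intro c hc
    rw [mem_chainsFrom, isSYTChain_iff] at hc
    rw [mem_sigma, mem_chainsFrom, isSYTChain_iff]
    refine ⟨⟨by rw [hinit c 0 (by omega)]; exact hc.1, fun i hi => ?_⟩, ?_⟩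
    · rw [hinit c i (by omega), hinit c (i + 1) (by omega)]
      exact hc.2 i (by omega)
    · simp only
      rw [hinit c n le_rfl]
      exact hc.2 n (by omega)
  · rintro ⟨c, κ⟩ h
    rw [mem_sigma, mem_chainsFrom, isSYTChain_iff] at h
    rw [mem_chainsFrom, isSYTChain_iff]
    simp only [seqOf_snocChain]
    refine ⟨by simpa using h.1.1, fun i hi => ?_⟩
    rw [if_pos (show i ≤ n by omega)]
    split_ifs with h1
    · exact h.1.2 i (by omega)
    · obtain rfl : i = n := by omega
      exact h.2
  · intro c _
    funext i
    rw [snocChain]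
    split_ifs with h
    · rw [hinit c i h, seqOf_of_le c (by omega)]
    · change seqOf c (n + 1) = c i
      rw [seqOf_of_le c le_rfl]
      exact congrArg c (Fin.ext (by change n + 1 = (i : ℕ); omega))
  · rintro ⟨c, κ⟩ _
    have h1 : (fun j : Fin (n + 1) => snocChain c κ j.castSucc) = c := by
      funext j
      rw [snocChain, if_pos (by simp only [Fin.val_castSucc]; omega),
        seqOf_of_le c (by simp only [Fin.val_castSucc]; omega)]
      rfl
    simp only [h1, seqOf_snocChain, if_neg (show ¬ n + 1 ≤ n by omega)]
  · intro c _
    congr 1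
    funext i
    rw [snocChain]
    split_ifs with h
    · rw [hinit c i h, seqOf_of_le c (by omega)]
    · rw [seqOf_of_le c le_rfl]
      congr 1
      ext
      simp only
      omega

theorem chainsFrom_zero (μ : YoungDiagram) : chainsFrom μ 0 = {fun _ => μ} := by
  ext c
  rw [mem_chainsFrom, mem_singleton]
  constructor
  · rintro ⟨h, -⟩
    funext i
    rw [← h, seqOf_of_le c le_rfl]
    exact congrArg c (Fin.ext (by omega))
  · rintro rfl
    exact ⟨rfl, fun i hi => absurd hi (by omega)⟩

/-- Sums over chains, weighted by the major index of the tail. -/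
theorem sum_chainsFrom_add (q : ℝ) (μ : YoungDiagram) (m : ℕ) (w : (ℕ → YoungDiagram) → ℝ)
    (hw : ∀ d e : ℕ → YoungDiagram, (∀ i ≤ m, d i = e i) → w d = w e) (N : ℕ)
    (h : YoungDiagram × ℕ → ℝ) :
    ∑ c ∈ chainsFrom μ (m + N), w (seqOf c) * q ^ majSeq N (fun i => seqOf c (m + i)) *
        h (seqOf c (m + N), lastRow (fun i => seqOf c (m + i)) N) =
      ∑ c ∈ chainsFrom μ m, w (seqOf c) * walkOp q N h (seqOf c m) := by
  induction N generalizing h with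
  | zero =>
    refine sum_congr rfl fun c _ => ?_
    simp [majSeq, lastRow, walkOp, LinearMap.funLeft_apply]
  | succ N ih =>
    rw [show walkOp q (N + 1) h = walkOp q N (stepOp q N h) from rfl, ← ih,
      show m + (N + 1) = m + N + 1 from rfl, sum_chainsFrom_succ]
    refine sum_congr rfl fun c _ => ?_
    change _ = _ * ∑ κ ∈ addStrip 1 (seqOf c (m + N)), _
    rw [mul_sum]
    refine sum_congr rfl fun κ _ => ?_
    have hlow : ∀ i ≤ m + N, seqOf (snocChain c κ) i = seqOf c i := fun i hi => by
      rw [seqOf_snocChain, if_pos hi]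
    have htop : seqOf (snocChain c κ) (m + N + 1) = κ := by
      rw [seqOf_snocChain, if_neg (by omega)]
    have hshift : ∀ i ≤ N, seqOf (snocChain c κ) (m + i) = seqOf c (m + i) :=
      fun i hi => hlow _ (by omega)
    rw [hw _ (seqOf c) fun i hi => hlow i (by omega), majSeq_succ, majSeq_congr hshift,
      lastRow_congr hshift, lastRow, htop, hshift N le_rfl,
      show m + (N + 1) = m + N + 1 from rfl, htop]
    split_ifs
    · rw [pow_add]
      ring
    · rw [add_zero]
      ring

theorem sum_chainsFrom_apply (μ : YoungDiagram) (m : ℕ) (g : YoungDiagram → ℝ) :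
    ∑ c ∈ chainsFrom μ m, g (seqOf c m) = (upOp 1 ^ m) g μ := by
  induction m generalizing g with
  | zero => rw [chainsFrom_zero, sum_singleton]; rfl
  | succ m ih =>
    rw [sum_chainsFrom_succ, pow_succ, Module.End.mul_apply, ← ih]
    refine sum_congr rfl fun c _ => ?_
    rw [upOp_apply]
    refine sum_congr rfl fun κ _ => ?_
    rw [seqOf_snocChain, if_neg (by omega)]

open scoped Classical in
theorem fSkew_eq (q : ℝ) (μ α : YoungDiagram) (n : ℕ) :
    fSkew μ α n q = majOp q n (Pi.single α 1) μ := by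
  have h := sum_chainsFrom_add q μ 0 (fun _ => 1) (fun _ _ _ => rfl) n
    (stripOp 0 (Pi.single α 1))
  rw [chainsFrom_zero, sum_singleton, one_mul] at h
  change _ = majOp q n (Pi.single α 1) μ at h
  rw [← h, fSkew, Nat.zero_add]
  have : skewSYT μ α n = (chainsFrom μ n).filter fun c => seqOf c n = α := by
    ext c
    rw [mem_skewSYT, mem_filter]
  rw [this, sum_filter]
  refine sum_congr rfl fun c _ => ?_
  rw [stripOp_zero_apply, Pi.single_apply, chainMaj_eq_majSeq]
  simp only [Nat.zero_add]
  split_ifs <;> simp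

theorem chainMaj_tailChain {m N : ℕ} (c : Fin (m + N + 1) → YoungDiagram) :
    chainMaj (tailChain c m) = majSeq N fun i => seqOf c (m + i) := by
  rw [chainMaj_eq_majSeq, majSeq_congr fun i _ => seqOf_tailChain c m i, Nat.add_sub_cancel_left]

/-- The denominator of the ratio. -/
theorem sum_allSYT_tail (q : ℝ) (m N : ℕ) :
    ∑ T ∈ allSYT (m + N), q ^ chainMaj (tailChain T m) =
      (upOp 1 ^ m) (majOp q N fun _ => 1) ⊥ := by
  have h := sum_chainsFrom_add q ⊥ m (fun _ => 1) (fun _ _ _ => rfl) N (stripOp 0 fun _ => 1)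
  simp only [one_mul] at h
  rw [← sum_chainsFrom_apply]
  change _ = ∑ c ∈ chainsFrom ⊥ m, walkOp q N (stripOp 0 fun _ => 1) (seqOf c m)
  rw [← h, allSYT_eq]
  refine sum_congr rfl fun c _ => ?_
  rw [stripOp_zero_apply, mul_one, chainMaj_tailChain]

-- The numerator of the ratio.
open scoped Classical in
theorem sum_allSYT_contains (q : ℝ) {m : ℕ} {α : YoungDiagram} {A : Fin (m + 1) → YoungDiagram}
    (hA : A ∈ skewSYT ⊥ α m) (N : ℕ) :
    ∑ T ∈ (allSYT (m + N)).filter (fun T => containsT T A), q ^ chainMaj (tailChain T m) =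
      majOp q N (fun _ => 1) α := by
  rw [mem_skewSYT] at hA
  have h := sum_chainsFrom_add q ⊥ m (fun d => if ∀ i ≤ m, d i = seqOf A i then 1 else 0)
    (fun d e hde => by
      refine if_congr (forall₂_congr fun i hi => ?_) rfl rfl
      rw [hde i hi]) N (stripOp 0 fun _ => 1)
  have hR : ∑ c ∈ chainsFrom ⊥ m, (if ∀ i ≤ m, seqOf c i = seqOf A i then (1 : ℝ) else 0) *
      walkOp q N (stripOp 0 fun _ => 1) (seqOf c m) = majOp q N (fun _ => 1) α := by
    rw [sum_eq_single_of_mem A hA.1]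
    · rw [if_pos fun _ _ => rfl, one_mul, hA.2]
      rfl
    · intro c _ hc
      rw [if_neg, zero_mul]
      intro hh
      apply hc
      funext i
      have := hh i (by omega)
      rwa [seqOf_of_le c (by omega), seqOf_of_le A (by omega)] at this
  rw [← hR, ← h, allSYT_eq, sum_filter]
  refine sum_congr rfl fun T _ => ?_
  have hiff : containsT T A ↔ ∀ i ≤ m, seqOf T i = seqOf A i := by
    constructor
    · intro hT i hi
      rw [seqOf_of_le A hi]
      exact hT ⟨i, by omega⟩
    · intro hT i
      have := hT i (by omega)
      rwa [seqOf_of_le A (by omega)] at this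
  rw [stripOp_zero_apply, mul_one, chainMaj_tailChain]
  by_cases hc : containsT T A
  · rw [if_pos hc, if_pos (hiff.1 hc), one_mul]
  · rw [if_neg hc, if_neg (fun hh => hc (hiff.2 hh)), zero_mul]

/-! ### Power series over a ring and the substitution `X ↦ q X` -/

theorem coeff_mul_of_low_eq_zero {S : Type*} [Ring S] {g : PowerSeries S} {n : ℕ}
    (hg : ∀ i < n, PowerSeries.coeff i g = 0) (A B : PowerSeries S) :
    PowerSeries.coeff n (A * g * B) =
      PowerSeries.coeff 0 A * PowerSeries.coeff n g * PowerSeries.coeff 0 B := by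
  have key : ∀ i ≤ n, PowerSeries.coeff i (A * g) =
      PowerSeries.coeff 0 A * PowerSeries.coeff i g := by
    intro i hi
    rw [PowerSeries.coeff_mul]
    refine sum_eq_single_of_mem (0, i) (by simp) fun p hp hne => ?_
    rw [HasAntidiagonal.mem_antidiagonal] at hp
    have : p.2 ≠ i := fun h => hne (Prod.ext (by simp only; omega) h)
    rw [hg _ (by omega), mul_zero]
  rw [PowerSeries.coeff_mul, ← key n le_rfl]
  refine sum_eq_single_of_mem (n, 0) (by simp) fun p hp hne => ?_
  rw [HasAntidiagonal.mem_antidiagonal] at hp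
  have : p.1 ≠ n := fun h => hne (Prod.ext h (by simp only; omega))
  rw [key _ (by omega), hg _ (by omega), mul_zero, zero_mul]

section Rescale

variable {S : Type*} [Ring S] [Algebra ℝ S]

/-- The substitution `X ↦ q X` for power series over a possibly noncommutative ring. -/
noncomputable def rescaleX (q : ℝ) (f : PowerSeries S) : PowerSeries S :=
  PowerSeries.mk fun n => q ^ n • PowerSeries.coeff n f

theorem coeff_rescaleX (q : ℝ) (f : PowerSeries S) (n : ℕ) :
    PowerSeries.coeff n (rescaleX q f) = q ^ n • PowerSeries.coeff n f :=
  PowerSeries.coeff_mk _ _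

theorem rescaleX_mul (q : ℝ) (f g : PowerSeries S) :
    rescaleX q (f * g) = rescaleX q f * rescaleX q g := by
  ext n
  rw [coeff_rescaleX, PowerSeries.coeff_mul, PowerSeries.coeff_mul, smul_sum]
  refine sum_congr rfl fun p hp => ?_
  rw [coeff_rescaleX, coeff_rescaleX, smul_mul_smul_comm, ← pow_add, HasAntidiagonal.mem_antidiagonal.1 hp]

theorem rescaleX_sub (q : ℝ) (f g : PowerSeries S) :
    rescaleX q (f - g) = rescaleX q f - rescaleX q g := by
  ext n
  simp [coeff_rescaleX, smul_sub]

theorem rescaleX_add (q : ℝ) (f g : PowerSeries S) :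
    rescaleX q (f + g) = rescaleX q f + rescaleX q g := by
  ext n
  simp [coeff_rescaleX, smul_add]

theorem rescaleX_smul (q c : ℝ) (f : PowerSeries S) :
    rescaleX q (c • f) = c • rescaleX q f := by
  ext n
  simp only [coeff_rescaleX, PowerSeries.coeff_smul, smul_comm c]

theorem rescaleX_C (q : ℝ) (s : S) : rescaleX q (PowerSeries.C s) = PowerSeries.C s := by
  ext n
  rw [coeff_rescaleX, PowerSeries.coeff_C]
  split_ifs with h <;> simp [h]

/-- Uniqueness for the functional equation `f(X) = A(X) f(qX) B(X)`. -/
theorem eq_zero_of_functional_equation {q : ℝ} (hq : ∀ n : ℕ, 0 < n → q ^ n ≠ 1)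
    {f A B : PowerSeries S} (hA : PowerSeries.coeff 0 A = 1) (hB : PowerSeries.coeff 0 B = 1)
    (h0 : PowerSeries.coeff 0 f = 0) (hf : f = A * rescaleX q f * B) : f = 0 := by
  ext n
  rw [map_zero]
  induction n using Nat.strong_induction_on with
  | _ n ih =>
    rcases Nat.eq_zero_or_pos n with rfl | hn
    · exact h0
    have h1 : PowerSeries.coeff n f = q ^ n • PowerSeries.coeff n f := by
      conv_lhs => rw [hf, coeff_mul_of_low_eq_zero (fun i hi => by
        rw [coeff_rescaleX, ih i hi, smul_zero]), hA, hB, one_mul, mul_one, coeff_rescaleX]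
    have h2 : (1 - q ^ n) • PowerSeries.coeff n f = 0 := by
      rw [sub_smul, one_smul, ← h1, sub_self]
    exact (smul_eq_zero_iff_right (sub_ne_zero.2 (hq n hn).symm)).1 h2

/-- A form of uniqueness for two solutions of the same functional equation. -/
theorem eq_of_functional_equation {q : ℝ} (hq : ∀ n : ℕ, 0 < n → q ^ n ≠ 1)
    {f g A B : PowerSeries S} (hA : PowerSeries.coeff 0 A = 1)
    (hB : PowerSeries.coeff 0 B = 1)
    (h0 : PowerSeries.coeff 0 f = PowerSeries.coeff 0 g)
    (hf : f = A * rescaleX q f * B) (hg : g = A * rescaleX q g * B) : f = g := by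
  refine sub_eq_zero.1 (eq_zero_of_functional_equation hq hA hB ?_ ?_)
  · rw [map_sub, h0, sub_self]
  · rw [rescaleX_sub, mul_sub, sub_mul, ← hf, ← hg]

end Rescale

/-- The `q`-Pochhammer symbol `(q; q)_n`. -/
noncomputable def qPoch (q : ℝ) (n : ℕ) : ℝ := ∏ i ∈ range n, (1 - q ^ (i + 1))

theorem qPoch_succ (q : ℝ) (n : ℕ) : qPoch q (n + 1) = qPoch q n * (1 - q ^ (n + 1)) :=
  prod_range_succ _ _

theorem qPoch_zero (q : ℝ) : qPoch q 0 = 1 := prod_range_zero _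

theorem pow_ne_one_of_pos {q : ℝ} (hq : 0 < q) (hq1 : q ≠ 1) (n : ℕ) (hn : 0 < n) :
    q ^ n ≠ 1 := fun h => hq1 ((pow_eq_one_iff_of_nonneg hq.le hn.ne').1 h)

theorem qPoch_ne_zero {q : ℝ} (hq : ∀ n : ℕ, 0 < n → q ^ n ≠ 1) (n : ℕ) : qPoch q n ≠ 0 :=
  prod_ne_zero_iff.2 fun i _ => sub_ne_zero.2 (hq (i + 1) i.succ_pos).symm

/-- Recursion for the coefficients of the `q`-exponential series. -/
theorem inv_qPoch_succ {q : ℝ} (hq : ∀ n : ℕ, 0 < n → q ^ n ≠ 1) (n : ℕ) :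
    (qPoch q (n + 1))⁻¹ = q ^ (n + 1) * (qPoch q (n + 1))⁻¹ + (qPoch q n)⁻¹ := by
  have h := sub_ne_zero.2 (hq (n + 1) n.succ_pos).symm
  have h' := qPoch_ne_zero hq n
  rw [qPoch_succ]
  field_simp
  ring

theorem sum_antidiagonal_inv_qPoch {q : ℝ} (hq : ∀ n : ℕ, 0 < n → q ^ n ≠ 1) (n : ℕ) :
    (qPoch q n)⁻¹ = ∑ p ∈ antidiagonal n, q ^ p.1 * (qPoch q p.1)⁻¹ := by
  induction n with
  | zero => simp [qPoch_zero]
  | succ n ih => exact (inv_qPoch_succ hq n).trans (by rw [Finset.Nat.sum_antidiagonal_succ', ← ih])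

section Commutation

variable {S : Type*} [Ring S] [Algebra ℝ S]

theorem mul_C_eq_of_functional_equation {q : ℝ} (hq : ∀ n : ℕ, 0 < n → q ^ n ≠ 1)
    {u w : ℕ → S} (hw0 : w 0 = 1) (hu0 : u 0 = 1)
    (hw : ∀ n, w n = ∑ p ∈ antidiagonal n, q ^ p.1 • (w p.1 * u p.2)) {y D : S}
    (hy : ∀ s, y * s = s * y)
    (huD : ∀ n, u n * D = ∑ p ∈ antidiagonal n, y ^ p.1 * D * u p.2) (n : ℕ) :
    w n * D = ∑ p ∈ antidiagonal n, (qPoch q p.1)⁻¹ • (y ^ p.1 * D * w p.2) := by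
  set Φ := PowerSeries.mk w with hΦ
  set U := PowerSeries.mk u with hU
  set K := PowerSeries.mk fun l => y ^ l with hK
  set κ := PowerSeries.mk fun l => (qPoch q l)⁻¹ • y ^ l with hκ
  have hpow : ∀ (l : ℕ) (s : S), y ^ l * s = s * y ^ l := fun l s =>
    ((show Commute y s from hy s).pow_left l).eq
  have hKc : ∀ f : PowerSeries S, K * f = f * K := by
    intro f
    ext n
    rw [PowerSeries.coeff_mul, PowerSeries.coeff_mul, ← Finset.Nat.sum_antidiagonal_swap]
    refine sum_congr rfl fun p _ => ?_
    rw [Prod.fst_swap, Prod.snd_swap, PowerSeries.coeff_mk, hpow]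
  have hΦeq : Φ = rescaleX q Φ * U := by
    ext n
    rw [PowerSeries.coeff_mk, hw, PowerSeries.coeff_mul]
    refine sum_congr rfl fun p _ => ?_
    rw [coeff_rescaleX, PowerSeries.coeff_mk, PowerSeries.coeff_mk, smul_mul_assoc]
  have hUD : U * PowerSeries.C D = K * (PowerSeries.C D * U) := by
    ext n
    rw [PowerSeries.coeff_mul_C, PowerSeries.coeff_mk, huD, PowerSeries.coeff_mul]
    refine sum_congr rfl fun p _ => ?_
    rw [PowerSeries.coeff_C_mul, PowerSeries.coeff_mk, PowerSeries.coeff_mk, mul_assoc]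
  have hκeq : κ = K * rescaleX q κ := by
    rw [hKc]
    ext n
    rw [PowerSeries.coeff_mk, PowerSeries.coeff_mul, sum_antidiagonal_inv_qPoch hq, sum_smul]
    refine sum_congr rfl fun p hp => ?_
    rw [coeff_rescaleX, PowerSeries.coeff_mk, PowerSeries.coeff_mk, smul_smul, smul_mul_assoc,
      ← pow_add, HasAntidiagonal.mem_antidiagonal.1 hp]
  have hmain : Φ * PowerSeries.C D = κ * (PowerSeries.C D * Φ) := by
    refine eq_of_functional_equation hq (A := K) (B := U) ?_ ?_ ?_ ?_ ?_
    · rw [PowerSeries.coeff_mk, pow_zero]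
    · rw [PowerSeries.coeff_mk, hu0]
    · rw [PowerSeries.coeff_mul_C, PowerSeries.coeff_mk, PowerSeries.coeff_mul]
      simp [hκ, hΦ, hw0, qPoch_zero]
    · conv_lhs => rw [hΦeq]
      rw [rescaleX_mul, rescaleX_C, mul_assoc, hUD, ← mul_assoc, ← hKc]
      simp only [mul_assoc]
    · conv_lhs => rw [hκeq, hΦeq]
      rw [rescaleX_mul, rescaleX_mul, rescaleX_C]
      simp only [mul_assoc]
  have := congrArg (PowerSeries.coeff n) hmain
  rw [PowerSeries.coeff_mul_C, PowerSeries.coeff_mk, PowerSeries.coeff_mul] at this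
  rw [this]
  refine sum_congr rfl fun p _ => ?_
  rw [PowerSeries.coeff_C_mul, PowerSeries.coeff_mk, PowerSeries.coeff_mk, smul_mul_assoc,
    mul_assoc]

end Commutation

/-! ### The normalized operators -/

/-- `majOp` divided by the `q`-Pochhammer symbol. -/
noncomputable def normOp (q : ℝ) (n : ℕ) : DiagramEnd := (qPoch q n)⁻¹ • majOp q n

theorem normOp_zero (q : ℝ) : normOp q 0 = 1 := by
  rw [normOp, qPoch_zero, majOp_zero, inv_one, one_smul]

theorem inv_qPoch_smul_walkOp {q : ℝ} (hq : ∀ n : ℕ, 0 < n → q ^ n ≠ 1) (N k : ℕ) :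
    (qPoch q N)⁻¹ • (walkOp q (N + 1) ∘ₗ stripOp k) =
      ∑ p ∈ antidiagonal N, q ^ p.1 • (normOp q p.1 * upOp (k + 1 + p.2)) := by
  induction N generalizing k with
  | zero =>
    rw [walkOp_succ_comp_stripOp, pow_zero, sub_self, zero_smul, add_zero, one_smul, qPoch_zero,
      inv_one, one_smul]
    simp [normOp_zero, majOp_zero]
  | succ N ih =>
    rw [walkOp_succ_comp_stripOp, Finset.Nat.sum_antidiagonal_succ', smul_add, smul_smul,
      smul_smul]
    have hne := sub_ne_zero.2 (hq (N + 1) N.succ_pos).symm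
    congr 1
    · rw [normOp, smul_mul_assoc, smul_smul, mul_comm, add_zero]
    · rw [qPoch_succ, mul_inv, mul_assoc, inv_mul_cancel₀ hne, mul_one, ih]
      refine sum_congr rfl fun p _ => ?_
      rw [show k + 1 + 1 + p.2 = k + 1 + (p.2 + 1) by omega]

theorem normOp_eq_sum {q : ℝ} (hq : ∀ n : ℕ, 0 < n → q ^ n ≠ 1) (n : ℕ) :
    normOp q n = ∑ p ∈ antidiagonal n, q ^ p.1 • (normOp q p.1 * upOp p.2) := by
  rcases n with _ | N
  · simp [normOp_zero, upOp_zero]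
  · have hne := sub_ne_zero.2 (hq (N + 1) N.succ_pos).symm
    have h := inv_qPoch_smul_walkOp hq N 0
    change (qPoch q N)⁻¹ • majOp q (N + 1) = _ at h
    have h2 : (qPoch q N)⁻¹ • majOp q (N + 1) = (1 - q ^ (N + 1)) • normOp q (N + 1) := by
      rw [normOp, smul_smul, qPoch_succ, mul_inv, mul_left_comm, mul_inv_cancel₀ hne, mul_one]
    have h3 : normOp q (N + 1) =
        (1 - q ^ (N + 1)) • normOp q (N + 1) + q ^ (N + 1) • normOp q (N + 1) := by module
    rw [h2] at h
    rw [h] at h3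
    rw [Finset.Nat.sum_antidiagonal_succ', upOp_zero, mul_one]
    refine (h3.trans (add_comm _ _)).trans ?_
    refine congrArg (_ + ·) (sum_congr rfl fun p _ => ?_)
    rw [show 0 + 1 + p.2 = p.2 + 1 by omega]

theorem normOp_mul_downOp {q : ℝ} (hq : ∀ n : ℕ, 0 < n → q ^ n ≠ 1) (n b : ℕ) :
    normOp q n * downOp b = ∑ p ∈ antidiagonal n,
      if p.1 ≤ b then (qPoch q p.1)⁻¹ • (downOp (b - p.1) * normOp q p.2) else 0 := by
  have hX : ∀ s : PowerSeries DiagramEnd, PowerSeries.X * s = s * PowerSeries.X := fun s =>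
    (PowerSeries.commute_X s).symm.eq
  have h := mul_C_eq_of_functional_equation (S := PowerSeries DiagramEnd) hq
    (u := fun n => PowerSeries.C (upOp n)) (w := fun n => PowerSeries.C (normOp q n))
    (y := PowerSeries.X) (D := PowerSeries.mk downOp) (by simp only [normOp_zero, map_one])
    (by simp only [upOp_zero, map_one]) (fun n => ?_) hX (fun n => ?_) n
  · have := congrArg (PowerSeries.coeff b) h
    rw [PowerSeries.coeff_C_mul, PowerSeries.coeff_mk, map_sum] at this
    rw [this]
    refine sum_congr rfl fun p _ => ?_
    rw [PowerSeries.coeff_smul, PowerSeries.coeff_mul_C, PowerSeries.coeff_X_pow_mul']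
    split_ifs
    · rw [PowerSeries.coeff_mk]
    · rw [zero_mul, smul_zero]
  · rw [normOp_eq_sum hq, map_sum]
    refine sum_congr rfl fun p _ => ?_
    rw [← map_mul]
    ext1 j
    rw [PowerSeries.coeff_smul, PowerSeries.coeff_C, PowerSeries.coeff_C]
    split_ifs
    · rfl
    · rw [smul_zero]
  · ext1 b
    rw [PowerSeries.coeff_C_mul, PowerSeries.coeff_mk, upOp_mul_downOp, map_sum,
      Finset.Nat.sum_antidiagonal_eq_sum_range_succ_mk]
    simp only [PowerSeries.coeff_mul_C, PowerSeries.coeff_X_pow_mul', PowerSeries.coeff_mk]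
    rw [← sum_subset (range_mono (show min n b + 1 ≤ n + 1 by omega))]
    · refine sum_congr rfl fun l hl => ?_
      rw [mem_range] at hl
      rw [if_pos (by omega)]
    · intro l hl' hl
      rw [mem_range] at hl' hl
      rw [if_neg (by omega), zero_mul]

/-- The projection of a function onto constants, by evaluation at the empty diagram. -/
noncomputable def constOp : DiagramEnd where
  toFun g _ := g ⊥
  map_add' _ _ := rfl
  map_smul' _ _ := rfl

theorem constOp_apply (g : YoungDiagram → ℝ) (α : YoungDiagram) : constOp g α = g ⊥ := rfl

theorem upOp_mul_constOp (k : ℕ) :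
    upOp k * constOp = ∑ p ∈ antidiagonal k, downOp p.2 * constOp := by
  ext g α
  rw [Module.End.mul_apply, LinearMap.sum_apply, Finset.sum_apply,
    ← Finset.Nat.sum_antidiagonal_swap, Finset.Nat.sum_antidiagonal_eq_sum_range_succ_mk]
  simp only [Module.End.mul_apply, upOp_apply, downOp_apply, constOp_apply, sum_const, nsmul_eq_mul,
    Prod.snd_swap]
  rw [card_addStrip, Nat.cast_sum, sum_mul]

/-- The coefficients of `∑ q ^ l / (q; q)_l X ^ (2 l)`. -/
noncomputable def evenCoeff (q : ℝ) (n : ℕ) : ℝ :=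
  if Even n then q ^ (n / 2) * (qPoch q (n / 2))⁻¹ else 0

/-- The coefficients of the series `s(X) = (1 - X)⁻¹ ∑ q ^ l / (q; q)_l X ^ (2 l)`. -/
noncomputable def sCoeff (q : ℝ) (n : ℕ) : ℝ := ∑ p ∈ antidiagonal n, evenCoeff q p.2

theorem sum_normOp_mul_downOp {q : ℝ} (hq : ∀ n : ℕ, 0 < n → q ^ n ≠ 1) (n : ℕ) :
    ∑ p ∈ antidiagonal n, q ^ p.1 • (normOp q p.1 * downOp p.2) =
      ∑ p ∈ antidiagonal n, evenCoeff q p.1 •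
        ∑ r ∈ antidiagonal p.2, q ^ r.2 • (downOp r.1 * normOp q r.2) := by
  simp only [normOp_mul_downOp hq, smul_sum, evenCoeff]
  rw [sum_sigma', sum_sigma']
  refine (sum_filter_of_ne (p := fun x : (_ : ℕ × ℕ) × ℕ × ℕ => x.2.1 ≤ x.1.2) ?_).symm.trans
    (Eq.trans ?_ (sum_filter_of_ne (p := fun x : (_ : ℕ × ℕ) × ℕ × ℕ => Even x.1.1) ?_))
  · rintro ⟨⟨a, b⟩, ⟨l, i⟩⟩ _ h
    by_contra hc
    exact h (by simp only [if_neg hc, smul_zero])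
  · refine sum_nbij'
      (fun x => ⟨(2 * x.2.1, x.1.2 - x.2.1 + x.2.2), (x.1.2 - x.2.1, x.2.2)⟩)
      (fun x => ⟨(x.1.1 / 2 + x.2.2, x.1.1 / 2 + x.2.1), (x.1.1 / 2, x.2.2)⟩) ?_ ?_ ?_ ?_ ?_
    · rintro ⟨⟨a, b⟩, ⟨l, i⟩⟩ h
      simp only [mem_filter, mem_sigma, HasAntidiagonal.mem_antidiagonal] at h ⊢
      refine ⟨⟨by omega, trivial⟩, even_two_mul l⟩
    · rintro ⟨⟨x, y⟩, ⟨j, i⟩⟩ h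
      simp only [mem_filter, mem_sigma, HasAntidiagonal.mem_antidiagonal] at h ⊢
      obtain ⟨h1, k, rfl⟩ := h
      refine ⟨⟨by omega, trivial⟩, by omega⟩
    · rintro ⟨⟨a, b⟩, ⟨l, i⟩⟩ h
      simp only [mem_filter, mem_sigma, HasAntidiagonal.mem_antidiagonal] at h ⊢
      obtain ⟨⟨h1, rfl⟩, h3⟩ := h
      simp only [Nat.mul_div_cancel_left l (zero_lt_two)]
      rw [Nat.add_sub_cancel' h3]
    · rintro ⟨⟨x, y⟩, ⟨j, i⟩⟩ h
      simp only [mem_filter, mem_sigma, HasAntidiagonal.mem_antidiagonal] at h ⊢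
      obtain ⟨⟨h1, rfl⟩, h3⟩ := h
      rw [Nat.two_mul_div_two_of_even h3, Nat.add_sub_cancel_left]
    · rintro ⟨⟨a, b⟩, ⟨l, i⟩⟩ h
      simp only [mem_filter, mem_sigma, HasAntidiagonal.mem_antidiagonal] at h ⊢
      obtain ⟨⟨h1, rfl⟩, h3⟩ := h
      rw [if_pos h3, if_pos (even_two_mul l), Nat.mul_div_cancel_left l (zero_lt_two), smul_smul,
        smul_smul, pow_add]
      congr 1
      ring
  · rintro ⟨⟨x, y⟩, ⟨j, i⟩⟩ _ h
    by_contra hc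
    exact h (by simp only [if_neg hc, zero_smul])

/-! ### Dual operators and factorization of the generating function -/

section ScalarSeries

variable {S : Type*} [Ring S] [Algebra ℝ S]

theorem map_algebraMap_mul_comm (r : PowerSeries ℝ) (f : PowerSeries S) :
    PowerSeries.map (algebraMap ℝ S) r * f = f * PowerSeries.map (algebraMap ℝ S) r := by
  ext n
  rw [PowerSeries.coeff_mul, PowerSeries.coeff_mul, ← Finset.Nat.sum_antidiagonal_swap]
  refine sum_congr rfl fun p _ => ?_
  rw [Prod.fst_swap, Prod.snd_swap, PowerSeries.coeff_map, Algebra.commutes]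

theorem rescaleX_map_algebraMap (q : ℝ) (r : PowerSeries ℝ) :
    rescaleX q (PowerSeries.map (algebraMap ℝ S) r) =
      PowerSeries.map (algebraMap ℝ S) (rescaleX q r) := by
  ext n
  rw [coeff_rescaleX, PowerSeries.coeff_map, PowerSeries.coeff_map, coeff_rescaleX,
    Algebra.smul_def, smul_eq_mul, map_mul]

theorem coeff_map_algebraMap_mul (r : PowerSeries ℝ) (f : PowerSeries S) (n : ℕ) :
    PowerSeries.coeff n (PowerSeries.map (algebraMap ℝ S) r * f) =
      ∑ p ∈ antidiagonal n, PowerSeries.coeff p.1 r • PowerSeries.coeff p.2 f := by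
  rw [PowerSeries.coeff_mul]
  refine sum_congr rfl fun p _ => ?_
  rw [PowerSeries.coeff_map, Algebra.smul_def]

end ScalarSeries

/-- The transposed operator of `normOp q k`, restricted to pairs of diagrams whose sizes differ
by `k`. -/
noncomputable def dualOp (q : ℝ) (k : ℕ) : DiagramEnd := by
  classical exact
  { toFun := fun g α => if k ≤ α.card then
      ∑ μ ∈ diagramsOfCard (α.card - k), normOp q k (Pi.single α 1) μ * g μ else 0
    map_add' := fun g h => by
      ext α
      simp only [Pi.add_apply, mul_add, sum_add_distrib]
      split_ifs <;> simp
    map_smul' := fun c g => by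
      ext α
      simp only [Pi.smul_apply, smul_eq_mul, mul_left_comm _ c, ← mul_sum]
      split_ifs <;> simp }

open scoped Classical in
theorem dualOp_apply (q : ℝ) (k : ℕ) (g : YoungDiagram → ℝ) (α : YoungDiagram) :
    dualOp q k g α = if k ≤ α.card then
      ∑ μ ∈ diagramsOfCard (α.card - k), normOp q k (Pi.single α 1) μ * g μ else 0 := by
  rw [dualOp]
  simp only [LinearMap.coe_mk, AddHom.coe_mk]

theorem dualOp_zero (q : ℝ) : dualOp q 0 = 1 := by
  classical
  ext g α
  rw [dualOp_apply, if_pos (Nat.zero_le _), normOp_zero, Nat.sub_zero,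
    sum_eq_single_of_mem α (mem_diagramsOfCard.2 rfl)]
  · simp
  · intro μ _ h
    simp [h]

open scoped Classical in
theorem upOp_single (k : ℕ) (α : YoungDiagram) :
    upOp k (Pi.single α 1) = ∑ ν ∈ removeStrip k α, (Pi.single ν 1 : YoungDiagram → ℝ) := by
  ext ν
  rw [upOp_apply, Finset.sum_apply]
  simp only [Pi.single_apply, sum_ite_eq, sum_ite_eq']
  refine if_congr ?_ rfl rfl
  rw [mem_addStrip, mem_removeStrip, eq_comm]

theorem dualOp_eq_sum {q : ℝ} (hq : ∀ n : ℕ, 0 < n → q ^ n ≠ 1) (n : ℕ) :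
    dualOp q n = ∑ p ∈ antidiagonal n, q ^ p.2 • (downOp p.1 * dualOp q p.2) := by
  classical
  ext g α
  rw [LinearMap.sum_apply, Finset.sum_apply, dualOp_apply]
  simp only [LinearMap.smul_apply, Pi.smul_apply, Module.End.mul_apply, downOp_apply, smul_eq_mul]
  split_ifs with h
  · have h1 : ∀ μ, normOp q n (Pi.single α 1) μ = ∑ p ∈ antidiagonal n,
        ∑ ν ∈ removeStrip p.1 α, q ^ p.2 * normOp q p.2 (Pi.single ν 1) μ := by
      intro μ
      rw [normOp_eq_sum hq, ← Finset.Nat.sum_antidiagonal_swap, LinearMap.sum_apply,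
        Finset.sum_apply]
      refine sum_congr rfl fun p _ => ?_
      rw [LinearMap.smul_apply, Pi.smul_apply, Module.End.mul_apply, upOp_single, map_sum,
        Finset.sum_apply, smul_eq_mul, mul_sum]
      rfl
    simp only [h1, sum_mul]
    rw [sum_comm]
    refine sum_congr rfl fun p hp => ?_
    rw [HasAntidiagonal.mem_antidiagonal] at hp
    rw [sum_comm, mul_sum]
    refine sum_congr rfl fun ν hν => ?_
    have hc := (mem_removeStrip.1 hν).2
    rw [dualOp_apply, if_pos (by omega), show ν.card - p.2 = α.card - n by omega, mul_sum]
    exact sum_congr rfl fun μ _ => mul_assoc _ _ _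
  · refine (sum_eq_zero fun p hp => ?_).symm
    rw [HasAntidiagonal.mem_antidiagonal] at hp
    rw [sum_eq_zero, mul_zero]
    intro ν hν
    have hc := (mem_removeStrip.1 hν).2
    rw [dualOp_apply, if_neg (by omega)]

theorem mk_dualOp_eq {q : ℝ} (hq : ∀ n : ℕ, 0 < n → q ^ n ≠ 1) :
    PowerSeries.mk (dualOp q) = PowerSeries.mk downOp * rescaleX q (PowerSeries.mk (dualOp q)) := by
  ext1 n
  rw [PowerSeries.coeff_mk, dualOp_eq_sum hq, PowerSeries.coeff_mul]
  refine sum_congr rfl fun p _ => ?_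
  rw [coeff_rescaleX, PowerSeries.coeff_mk, PowerSeries.coeff_mk, mul_smul_comm]

theorem downOp_apply_bot {k : ℕ} (hk : k ≠ 0) (g : YoungDiagram → ℝ) : downOp k g ⊥ = 0 := by
  rw [downOp_apply, removeStrip_bot hk, sum_empty]

/-- The value of `normOp q n` at the empty diagram. -/
noncomputable def tau (q : ℝ) (n : ℕ) : ℝ := normOp q n (fun _ => 1) ⊥

theorem tau_zero (q : ℝ) : tau q 0 = 1 := by
  rw [tau, normOp_zero]; rfl

theorem mk_sCoeff (q : ℝ) : PowerSeries.mk (sCoeff q) =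
    PowerSeries.mk (fun _ => 1) * PowerSeries.mk (evenCoeff q) := by
  ext n
  rw [PowerSeries.coeff_mk, sCoeff, PowerSeries.coeff_mul]
  refine sum_congr rfl fun p _ => ?_
  rw [PowerSeries.coeff_mk, PowerSeries.coeff_mk, one_mul]

theorem mk_normOp_mul_constOp {q : ℝ} (hq : ∀ n : ℕ, 0 < n → q ^ n ≠ 1) :
    PowerSeries.mk (normOp q) * PowerSeries.C constOp =
      PowerSeries.map (algebraMap ℝ DiagramEnd) (PowerSeries.mk (sCoeff q)) *
        (PowerSeries.mk downOp * rescaleX q (PowerSeries.mk (normOp q)) *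
          PowerSeries.C constOp) := by
  set ι := PowerSeries.map (algebraMap ℝ DiagramEnd)
  have hΦ : PowerSeries.mk (normOp q) =
      rescaleX q (PowerSeries.mk (normOp q)) * PowerSeries.mk upOp := by
    ext1 n
    rw [PowerSeries.coeff_mk, normOp_eq_sum hq, PowerSeries.coeff_mul]
    refine sum_congr rfl fun p _ => ?_
    rw [coeff_rescaleX, PowerSeries.coeff_mk, PowerSeries.coeff_mk, smul_mul_assoc]
  have hU : PowerSeries.mk upOp * PowerSeries.C constOp =
      ι (PowerSeries.mk fun _ => 1) * (PowerSeries.mk downOp * PowerSeries.C constOp) := by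
    ext1 n
    rw [PowerSeries.coeff_mul_C, PowerSeries.coeff_mk, upOp_mul_constOp, coeff_map_algebraMap_mul]
    refine sum_congr rfl fun p _ => ?_
    rw [PowerSeries.coeff_mul_C, PowerSeries.coeff_mk, PowerSeries.coeff_mk, one_smul]
  have hΦD : rescaleX q (PowerSeries.mk (normOp q)) * PowerSeries.mk downOp =
      ι (PowerSeries.mk (evenCoeff q)) *
        (PowerSeries.mk downOp * rescaleX q (PowerSeries.mk (normOp q))) := by
    ext1 n
    rw [coeff_map_algebraMap_mul, PowerSeries.coeff_mul]
    simp only [PowerSeries.coeff_mul, coeff_rescaleX, PowerSeries.coeff_mk, mul_smul_comm,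
      smul_mul_assoc]
    exact sum_normOp_mul_downOp hq n
  conv_lhs => rw [hΦ, mul_assoc, hU, ← mul_assoc, ← map_algebraMap_mul_comm, mul_assoc,
    ← mul_assoc (rescaleX q _), hΦD]
  rw [mk_sCoeff, map_mul]
  simp only [ι, mul_assoc]

theorem tau_eq_sum {q : ℝ} (hq : ∀ n : ℕ, 0 < n → q ^ n ≠ 1) :
    PowerSeries.mk (tau q) = PowerSeries.mk (sCoeff q) * rescaleX q (PowerSeries.mk (tau q)) := by
  ext n
  have h := congrArg (fun f => PowerSeries.coeff n f) (mk_normOp_mul_constOp hq)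
  simp only [PowerSeries.coeff_mul_C, PowerSeries.coeff_mk, coeff_map_algebraMap_mul] at h
  have h1 := congrFun (congrArg (fun f : DiagramEnd => f fun _ => 1) h) ⊥
  rw [PowerSeries.coeff_mul]
  change tau q n = _ at h1
  rw [PowerSeries.coeff_mk, h1, LinearMap.sum_apply, Finset.sum_apply]
  refine sum_congr rfl fun p _ => ?_
  rw [PowerSeries.coeff_mk, coeff_rescaleX, PowerSeries.coeff_mk, LinearMap.smul_apply,
    Pi.smul_apply, smul_eq_mul]
  congr 1
  rw [Module.End.mul_apply, PowerSeries.coeff_mul, LinearMap.sum_apply, Finset.sum_apply,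
    sum_eq_single_of_mem (0, p.2) (by simp)]
  · rw [coeff_rescaleX, PowerSeries.coeff_mk, PowerSeries.coeff_mk, downOp_zero, one_mul]
    rfl
  · intro r hr hne
    rw [HasAntidiagonal.mem_antidiagonal] at hr
    rw [PowerSeries.coeff_mk, Module.End.mul_apply, downOp_apply_bot]
    exact fun h => hne (Prod.ext h (by simp only; omega))

theorem coeff_zero_sCoeff (q : ℝ) : sCoeff q 0 = 1 := by
  simp [sCoeff, evenCoeff, qPoch_zero]

/-- The values of `normOp` on the constant function factor through the dual operators. -/
theorem normOp_one_apply {q : ℝ} (hq : ∀ n : ℕ, 0 < n → q ^ n ≠ 1) (n : ℕ) (α : YoungDiagram) :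
    normOp q n (fun _ => 1) α =
      ∑ p ∈ antidiagonal n, tau q p.1 * dualOp q p.2 (fun _ => 1) α := by
  set ι := PowerSeries.map (algebraMap ℝ DiagramEnd)
  have key : PowerSeries.mk (normOp q) * PowerSeries.C constOp =
      ι (PowerSeries.mk (tau q)) * (PowerSeries.mk (dualOp q) * PowerSeries.C constOp) := by
    refine eq_of_functional_equation hq
      (A := ι (PowerSeries.mk (sCoeff q)) * PowerSeries.mk downOp) (B := 1) ?_ ?_ ?_ ?_ ?_
    · simp [ι, coeff_map_algebraMap_mul, coeff_zero_sCoeff, downOp_zero]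
    · simp
    · simp [ι, coeff_map_algebraMap_mul, tau_zero, normOp_zero, dualOp_zero]
    · conv_lhs => rw [mk_normOp_mul_constOp hq]
      rw [rescaleX_mul, rescaleX_C, mul_one]
      simp only [ι, mul_assoc]
    · conv_lhs => rw [tau_eq_sum hq, mk_dualOp_eq hq]
      rw [rescaleX_mul, rescaleX_mul, rescaleX_C, mul_one, rescaleX_map_algebraMap, map_mul]
      have hcomm := map_algebraMap_mul_comm (rescaleX q (PowerSeries.mk (tau q)))
        (PowerSeries.mk downOp)
      simp only [ι, mul_assoc]
      congr 1
      rw [← mul_assoc, hcomm, mul_assoc]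
  have h := congrArg (fun f => PowerSeries.coeff n f) key
  simp only [ι, PowerSeries.coeff_mul_C, PowerSeries.coeff_mk, coeff_map_algebraMap_mul] at h
  have h1 := congrFun (congrArg (fun f : DiagramEnd => f fun _ => 1) h) α
  rw [LinearMap.sum_apply, Finset.sum_apply] at h1
  exact h1

theorem upOp_one_mul_downOp (b : ℕ) :
    upOp 1 * downOp b = downOp b * upOp 1 + if b = 0 then 0 else downOp (b - 1) := by
  rw [upOp_mul_downOp]
  rcases b with _ | b
  · simp
  · rw [show min 1 (b + 1) = 1 by omega, sum_range_succ, sum_range_one]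
    simp [upOp_zero]

/-- Commutation of adding a cell with the dual operators. -/
theorem upOp_one_mul_dualOp {q : ℝ} (hq : ∀ n : ℕ, 0 < n → q ^ n ≠ 1) (n : ℕ) :
    upOp 1 * dualOp q (n + 1) = dualOp q (n + 1) * upOp 1 + (1 - q)⁻¹ • dualOp q n := by
  have hq1 : 1 - q ≠ 0 := sub_ne_zero.2 (by simpa using (hq 1 one_pos).symm)
  set Ψ := PowerSeries.mk (dualOp q)
  set V := PowerSeries.C (upOp 1)
  set X : PowerSeries DiagramEnd := PowerSeries.X
  have hXc : ∀ f : PowerSeries DiagramEnd, X * f = f * X := fun f =>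
    (PowerSeries.commute_X f).symm.eq
  have hrX : ∀ f : PowerSeries DiagramEnd, rescaleX q (X * f) = q • (X * rescaleX q f) := by
    intro f
    ext1 j
    rw [coeff_rescaleX, PowerSeries.coeff_smul]
    rcases j with _ | j
    · rw [PowerSeries.coeff_zero_X_mul, PowerSeries.coeff_zero_X_mul, smul_zero, smul_zero]
    · rw [PowerSeries.coeff_succ_X_mul, PowerSeries.coeff_succ_X_mul, coeff_rescaleX, smul_smul,
        pow_succ']
  have hD : V * PowerSeries.mk downOp = PowerSeries.mk downOp * V + X * PowerSeries.mk downOp := by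
    ext1 j
    rw [map_add, PowerSeries.coeff_C_mul, PowerSeries.coeff_mul_C, PowerSeries.coeff_mk,
      upOp_one_mul_downOp]
    congr 1
    rcases j with _ | j
    · rw [if_pos rfl, PowerSeries.coeff_zero_X_mul]
    · rw [if_neg j.succ_ne_zero, PowerSeries.coeff_succ_X_mul, PowerSeries.coeff_mk,
        Nat.add_sub_cancel]
  have hΨ : Ψ = PowerSeries.mk downOp * rescaleX q Ψ := mk_dualOp_eq hq
  have key : V * Ψ - (Ψ * V + (1 - q)⁻¹ • (X * Ψ)) = 0 := by
    refine eq_zero_of_functional_equation hq (A := PowerSeries.mk downOp) (B := 1) ?_ ?_ ?_ ?_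
    · simp [downOp_zero]
    · simp
    · simp [V, Ψ, X, dualOp_zero]
    · rw [rescaleX_sub, rescaleX_add, rescaleX_mul, rescaleX_mul, rescaleX_smul, rescaleX_C, hrX]
      set R := rescaleX q Ψ
      have h1 : V * Ψ = PowerSeries.mk downOp * (V * R) + X * (PowerSeries.mk downOp * R) := by
        rw [hΨ, ← mul_assoc, hD, add_mul, mul_assoc, mul_assoc]
      have h2 : PowerSeries.mk downOp * (X * R) = X * (PowerSeries.mk downOp * R) := by
        rw [← mul_assoc, ← hXc, mul_assoc]
      have h3 : Ψ * V = PowerSeries.mk downOp * (R * V) := by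
        rw [← mul_assoc, ← hΨ]
      rw [mul_one, mul_sub, mul_add, mul_smul_comm, mul_smul_comm, h1, h2, h3, smul_smul,
        show X * Ψ = X * (PowerSeries.mk downOp * R) by rw [← hΨ]]
      have hc : (1 : ℝ) = (1 - q)⁻¹ - (1 - q)⁻¹ * q := by
        rw [← mul_one_sub, inv_mul_cancel₀ hq1]
      generalize X * (PowerSeries.mk downOp * R) = Z at *
      have hZ : Z = (1 - q)⁻¹ • Z - ((1 - q)⁻¹ * q) • Z := by rw [← sub_smul, ← hc, one_smul]
      rw [add_sub_add_comm]
      nth_rewrite 1 [hZ]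
      abel
  have h := congrArg (fun f => PowerSeries.coeff (n + 1) f) (sub_eq_zero.1 key)
  simp only [V, Ψ, X, map_add, PowerSeries.coeff_mul_C, PowerSeries.coeff_C_mul,
    PowerSeries.coeff_mk, PowerSeries.coeff_smul, PowerSeries.coeff_succ_X_mul] at h
  exact h

/-! ### `q`-binomial coefficients -/

theorem qInt_add (q : ℝ) (a b : ℕ) : qInt q (a + b) = qInt q a + q ^ a * qInt q b := by
  rw [qInt, sum_range_add, qInt, qInt, mul_sum]
  simp only [pow_add]

theorem qFact_succ (q : ℝ) (n : ℕ) : qFact q (n + 1) = qFact q n * qInt q (n + 1) :=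
  prod_range_succ _ _

theorem qFact_pos {q : ℝ} (hq : 0 < q) (n : ℕ) : 0 < qFact q n :=
  prod_pos fun _ _ => sum_pos (fun _ _ => pow_pos hq _) nonempty_range_add_one

theorem qBinom_eq_zero_of_lt (q : ℝ) {n k : ℕ} (h : n < k) : qBinom q n k = 0 := by
  induction n generalizing k with
  | zero =>
    obtain ⟨k, rfl⟩ := Nat.exists_eq_add_of_lt h
    rfl
  | succ n ih =>
    obtain ⟨k, rfl⟩ : ∃ j, k = j + 1 := ⟨k - 1, by omega⟩
    rw [qBinom, ih (by omega), ih (by omega), mul_zero, add_zero]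

theorem qBinom_self (q : ℝ) (n : ℕ) : qBinom q n n = 1 := by
  induction n with
  | zero => rfl
  | succ n ih => rw [qBinom, ih, qBinom_eq_zero_of_lt q n.lt_succ_self, mul_zero, add_zero]

theorem qBinom_mul_qFact (q : ℝ) (i k : ℕ) :
    qBinom q (i + k) k * (qFact q i * qFact q k) = qFact q (i + k) := by
  induction h : i + k generalizing i k with
  | zero =>
    obtain ⟨rfl, rfl⟩ : i = 0 ∧ k = 0 := by omega
    simp [qBinom, qFact]
  | succ n ih =>
    rcases k with _ | k
    · obtain rfl : i = n + 1 := by omega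
      simp [qBinom, qFact]
    rcases i with _ | i
    · obtain rfl : k = n := by omega
      rw [qBinom_self]
      simp [qFact]
    have h1 := ih (i + 1) k (by omega)
    have h2 := ih i (k + 1) (by omega)
    have h3 : qInt q (n + 1) = qInt q (k + 1) + q ^ (k + 1) * qInt q (i + 1) := by
      rw [← qInt_add]
      congr 1
      omega
    rw [qBinom, qFact_succ q n, h3, qFact_succ q k, qFact_succ q i]
    rw [qFact_succ q i] at h1
    rw [qFact_succ q k] at h2
    linear_combination qInt q (k + 1) * h1 + q ^ (k + 1) * qInt q (i + 1) * h2

theorem qPoch_eq (q : ℝ) (n : ℕ) : qPoch q n = (1 - q) ^ n * qFact q n := by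
  rw [qPoch, qFact, ← card_range n, ← prod_const, card_range, ← prod_mul_distrib]
  refine prod_congr rfl fun i _ => ?_
  rw [qInt, mul_neg_geom_sum]

theorem qBinom_mul_qPoch (q : ℝ) (i k : ℕ) :
    qBinom q (i + k) k * (qPoch q i * qPoch q k) = qPoch q (i + k) := by
  rw [qPoch_eq, qPoch_eq, qPoch_eq, ← qBinom_mul_qFact, pow_add]
  ring

theorem continuous_qBinom (n k : ℕ) : Continuous fun q => qBinom q n k := by
  induction n generalizing k with
  | zero => cases k <;> exact continuous_const
  | succ n ih =>
    rcases k with _ | k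
    · exact continuous_const
    · exact (ih k).add ((continuous_pow _).mul (ih (k + 1)))

theorem continuous_qFact (n : ℕ) : Continuous fun q => qFact q n := by
  unfold qFact qInt
  fun_prop

/-! ### The numerator and the denominator as polynomials in `q` -/

/-- `t_n(q)`, as a sum over standard Young tableaux. -/
noncomputable def tMaj (q : ℝ) (n : ℕ) : ℝ := majOp q n (fun _ => 1) ⊥

/-- The sum of `f^{α/μ}(q)` over all `μ` of size `|α| - k`. -/
noncomputable def skewSum (q : ℝ) (k : ℕ) (α : YoungDiagram) : ℝ :=
  if k ≤ α.card then ∑ μ ∈ diagramsOfCard (α.card - k), fSkew μ α k q else 0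

theorem dualOp_one_apply (q : ℝ) (k : ℕ) (α : YoungDiagram) :
    dualOp q k (fun _ => 1) α = (qPoch q k)⁻¹ * skewSum q k α := by
  classical
  rw [dualOp_apply, skewSum]
  split_ifs
  · rw [mul_sum]
    refine sum_congr rfl fun μ _ => ?_
    rw [fSkew_eq, mul_one, normOp]
    rfl
  · rw [mul_zero]

theorem tau_eq (q : ℝ) (n : ℕ) : tau q n = (qPoch q n)⁻¹ * tMaj q n := rfl

theorem majOp_one_apply_eq_sum (q : ℝ) (N : ℕ) (α : YoungDiagram) :
    majOp q N (fun _ => 1) α =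
      ∑ c ∈ chainsFrom α (0 + N), q ^ majSeq N fun i => seqOf c (0 + i) := by
  have h := sum_chainsFrom_add q α 0 (fun _ => 1) (fun _ _ _ => rfl) N (stripOp 0 fun _ => 1)
  rw [chainsFrom_zero, sum_singleton, one_mul] at h
  refine h.symm.trans (sum_congr rfl fun c _ => ?_)
  rw [stripOp_zero_apply, mul_one, one_mul]

theorem continuous_majOp_one_apply (N : ℕ) (α : YoungDiagram) :
    Continuous fun q => majOp q N (fun _ => 1) α := by
  simp only [majOp_one_apply_eq_sum]
  fun_prop

theorem continuous_skewSum (k : ℕ) (α : YoungDiagram) : Continuous fun q => skewSum q k α := by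
  unfold skewSum fSkew
  split_ifs <;> fun_prop

theorem tMaj_nonneg {q : ℝ} (hq : 0 ≤ q) (n : ℕ) : 0 ≤ tMaj q n := by
  rw [tMaj, majOp_one_apply_eq_sum]
  exact sum_nonneg fun _ _ => pow_nonneg hq _

theorem tMaj_one (n : ℕ) : tMaj 1 n = (upOp 1 ^ n) (fun _ => 1) ⊥ := by
  rw [tMaj, majOp_one_apply_eq_sum, ← sum_chainsFrom_apply, Nat.zero_add]
  simp only [one_pow]

theorem tMaj_zero (q : ℝ) : tMaj q 0 = 1 := by
  rw [tMaj, majOp_zero]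
  rfl

/-- Two continuous functions that agree for positive `q ≠ 1` agree for all positive `q`. -/
theorem eq_of_eq_of_ne_one {f g : ℝ → ℝ} (hf : Continuous f) (hg : Continuous g)
    (h : ∀ q, 0 < q → q ≠ 1 → f q = g q) {q : ℝ} (hq : 0 < q) : f q = g q := by
  by_cases hq1 : q = 1
  · subst hq1
    refine tendsto_nhds_unique (l := nhdsWithin (1 : ℝ) {1}ᶜ)
      (hf.continuousAt.tendsto.mono_left nhdsWithin_le_nhds) (Filter.Tendsto.congr' ?_
        (hg.continuousAt.tendsto.mono_left nhdsWithin_le_nhds))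
    filter_upwards [self_mem_nhdsWithin, nhdsWithin_le_nhds (lt_mem_nhds hq)] with x hx hx0
    exact (h x hx0 hx).symm
  · exact h q hq hq1

/-- The generating function of chains starting at `α`. -/
theorem majOp_one_apply {q : ℝ} (hq : 0 < q) (N : ℕ) (α : YoungDiagram) :
    majOp q N (fun _ => 1) α =
      ∑ p ∈ antidiagonal N, qBinom q N p.2 * tMaj q p.1 * skewSum q p.2 α := by
  refine eq_of_eq_of_ne_one (f := fun q => majOp q N (fun _ => 1) α) (g := fun q =>
    ∑ p ∈ antidiagonal N, qBinom q N p.2 * tMaj q p.1 * skewSum q p.2 α)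
    (continuous_majOp_one_apply N α) (continuous_finsetSum _ fun p _ => ((continuous_qBinom _ _).mul
      (continuous_majOp_one_apply _ _)).mul (continuous_skewSum _ _)) (fun q hq hq1 => ?_) hq
  have hq' := pow_ne_one_of_pos hq hq1
  have h := congrArg (qPoch q N * ·) (normOp_one_apply hq' N α)
  have hL : qPoch q N * normOp q N (fun _ => 1) α = majOp q N (fun _ => 1) α := by
    rw [normOp, LinearMap.smul_apply, Pi.smul_apply, smul_eq_mul, mul_inv_cancel_left₀
      (qPoch_ne_zero hq' N)]
  change _ = qPoch q N * _ at h
  simp only at h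
  rw [hL, mul_sum] at h
  refine h.trans (sum_congr rfl fun p hp => ?_)
  rw [HasAntidiagonal.mem_antidiagonal] at hp
  have h1 := qPoch_ne_zero hq' p.1
  have h2 := qPoch_ne_zero hq' p.2
  rw [dualOp_one_apply, tau_eq, ← hp, ← qBinom_mul_qPoch]
  field_simp

theorem upOp_pow_dualOp_apply_bot {q : ℝ} (hq : ∀ n : ℕ, 0 < n → q ^ n ≠ 1) (m k : ℕ)
    (g : YoungDiagram → ℝ) :
    (upOp 1 ^ m) (dualOp q k g) ⊥ =
      m.choose k * ((1 - q)⁻¹ ^ k * (upOp 1 ^ (m - k)) g ⊥) := by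
  induction m generalizing k g with
  | zero =>
    rcases k with _ | k
    · simp [dualOp_zero]
    · rw [pow_zero, Module.End.one_apply, dualOp_apply, if_neg (by rw [card_bot]; omega)]
      simp
  | succ m ih =>
    rcases k with _ | k
    · simp [dualOp_zero]
    · have h : (upOp 1 ^ (m + 1)) (dualOp q (k + 1) g) ⊥ = (upOp 1 ^ m)
          ((upOp 1 * dualOp q (k + 1)) g) ⊥ := by rw [pow_succ]; rfl
      rw [h, upOp_one_mul_dualOp hq, LinearMap.add_apply, map_add, Pi.add_apply,
        LinearMap.smul_apply, map_smul, Pi.smul_apply, Module.End.mul_apply, ih, ih,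
        Nat.choose_succ_succ, Nat.cast_add, Nat.add_sub_add_right, smul_eq_mul]
      rcases Nat.lt_or_ge m (k + 1) with hlt | hge
      · rw [Nat.choose_eq_zero_of_lt hlt]
        push_cast
        ring
      · have h2 : (upOp 1 ^ (m - (k + 1))) (upOp 1 g) ⊥ = (upOp 1 ^ (m - k)) g ⊥ := by
          rw [← Module.End.mul_apply, ← pow_succ, show m - (k + 1) + 1 = m - k by omega]
        rw [h2]
        ring

theorem continuous_upOp_pow_apply {f : ℝ → YoungDiagram → ℝ}
    (hf : ∀ α, Continuous fun q => f q α) (m : ℕ) (α : YoungDiagram) :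
    Continuous fun q => (upOp 1 ^ m) (f q) α := by
  simp only [← sum_chainsFrom_apply]
  exact continuous_finsetSum _ fun c _ => hf _

theorem upOp_pow_skewSum {q : ℝ} (hq : 0 < q) (m k : ℕ) :
    (upOp 1 ^ m) (skewSum q k) ⊥ =
      m.choose k * (qFact q k * (upOp 1 ^ (m - k)) (fun _ => 1) ⊥) := by
  refine eq_of_eq_of_ne_one (f := fun q => (upOp 1 ^ m) (skewSum q k) ⊥) (g := fun q =>
      m.choose k * (qFact q k * (upOp 1 ^ (m - k)) (fun _ => 1) ⊥))
    (continuous_upOp_pow_apply (continuous_skewSum k) m ⊥)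
    (continuous_const.mul ((continuous_qFact k).mul continuous_const)) (fun q hq hq1 => ?_) hq
  have hq' := pow_ne_one_of_pos hq hq1
  have h0 := qPoch_ne_zero hq' k
  have hs : skewSum q k = qPoch q k • dualOp q k fun _ => 1 := by
    ext α
    rw [Pi.smul_apply, dualOp_one_apply, smul_eq_mul, mul_inv_cancel_left₀ h0]
  simp only [hs]
  rw [map_smul, Pi.smul_apply, upOp_pow_dualOp_apply_bot hq', smul_eq_mul, qPoch_eq, inv_pow]
  have h1 : (1 - q) ^ k ≠ 0 := pow_ne_zero _ (sub_ne_zero.2 (Ne.symm hq1))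
  field_simp

/-! ### Counting involutions -/

theorem upOp_one_pow_mul_downOp_one (j : ℕ) :
    upOp 1 ^ (j + 1) * downOp 1 = downOp 1 * upOp 1 ^ (j + 1) + (j + 1 : ℝ) • upOp 1 ^ j := by
  have h1 : upOp 1 * downOp 1 = downOp 1 * upOp 1 + 1 := by
    simpa [downOp_zero] using upOp_one_mul_downOp 1
  induction j with
  | zero => simpa using h1
  | succ j ih =>
    rw [pow_succ', mul_assoc, ih, mul_add, ← mul_assoc, h1, mul_smul_comm, ← pow_succ', add_mul,
      one_mul, mul_assoc, ← pow_succ']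
    push_cast
    module

theorem upOp_one_pow_one_apply_bot (j : ℕ) :
    (upOp 1 ^ (j + 2)) (fun _ => 1) ⊥ =
      (upOp 1 ^ (j + 1)) (fun _ => 1) ⊥ + (j + 1 : ℝ) * (upOp 1 ^ j) (fun _ => 1) ⊥ := by
  have h : upOp 1 (fun _ => 1) = (fun _ => 1) + downOp 1 fun _ => 1 := by
    have h1 := congrArg (fun f : DiagramEnd => f fun _ => 1) (upOp_mul_constOp 1)
    rw [Finset.Nat.sum_antidiagonal_eq_sum_range_succ_mk, sum_range_succ, sum_range_one] at h1
    refine h1.trans ?_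
    simp only [LinearMap.add_apply, Module.End.mul_apply, Nat.sub_self, Nat.sub_zero, downOp_zero]
    exact add_comm _ _
  rw [pow_succ, Module.End.mul_apply, h, map_add, Pi.add_apply, ← Module.End.mul_apply,
    upOp_one_pow_mul_downOp_one, LinearMap.add_apply, Pi.add_apply, Module.End.mul_apply,
    downOp_apply_bot one_ne_zero, zero_add]
  rfl

theorem mem_involutions {n : ℕ} {π : Equiv.Perm (Fin n)} :
    π ∈ involutions n ↔ ∀ z, π (π z) = z := by
  rw [involutions, mem_filter, Equiv.ext_iff]
  simp

theorem card_involutions_map_zero (n : ℕ) (y : Fin (n + 1)) :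
    ((involutions (n + 1)).filter fun π => π 0 = y).card =
      (univ.filter fun σ : Equiv.Perm (Fin n) =>
        Equiv.Perm.decomposeFin.symm (y, σ) ∈ involutions (n + 1)).card := by
  have hrec : ∀ π : Equiv.Perm (Fin (n + 1)), π 0 = y →
      Equiv.Perm.decomposeFin.symm (y, (Equiv.Perm.decomposeFin π).2) = π := by
    intro π hπ
    have h : (Equiv.Perm.decomposeFin π).1 = y := by
      rw [← hπ]
      conv_rhs => rw [← Equiv.Perm.decomposeFin.symm_apply_apply π]
      exact (Equiv.Perm.decomposeFin_symm_apply_zero _ _).symm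
    rw [← h]
    exact Equiv.Perm.decomposeFin.symm_apply_apply π
  refine card_nbij' (fun π => (Equiv.Perm.decomposeFin π).2)
    (fun σ => Equiv.Perm.decomposeFin.symm (y, σ)) ?_ ?_ ?_ ?_
  · intro π hπ
    rw [mem_coe, mem_filter] at hπ ⊢
    refine ⟨mem_univ _, ?_⟩
    rw [hrec π hπ.2]
    exact hπ.1
  · intro σ hσ
    rw [mem_coe, mem_filter] at hσ ⊢
    exact ⟨hσ.2, Equiv.Perm.decomposeFin_symm_apply_zero y σ⟩
  · intro π hπ
    rw [mem_coe, mem_filter] at hπ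
    exact hrec π hπ.2
  · intro σ _
    simp only [Equiv.apply_symm_apply]

theorem decomposeFin_symm_zero_mem_involutions {n : ℕ} (σ : Equiv.Perm (Fin n)) :
    Equiv.Perm.decomposeFin.symm (0, σ) ∈ involutions (n + 1) ↔ σ ∈ involutions n := by
  rw [mem_involutions, mem_involutions, Fin.forall_fin_succ]
  simp

theorem decomposeFin_symm_succ_mem_involutions {n : ℕ} (x : Fin n) (σ : Equiv.Perm (Fin n)) :
    Equiv.Perm.decomposeFin.symm (x.succ, σ) ∈ involutions (n + 1) ↔
      σ ∈ involutions n ∧ σ x = x := by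
  rw [mem_involutions, mem_involutions, Fin.forall_fin_succ]
  simp only [Equiv.Perm.decomposeFin_symm_apply_zero, Equiv.Perm.decomposeFin_symm_apply_succ]
  constructor
  · rintro ⟨h0, h⟩
    have hx : σ x = x := by
      rw [Equiv.swap_apply_eq_iff, Equiv.swap_apply_left] at h0
      exact Fin.succ_injective _ h0
    refine ⟨fun z => ?_, hx⟩
    by_cases hz : σ z = x
    · rw [hz, hx, ← σ.injective (hz.trans hx.symm)]
    · have h1 := h z
      rw [Equiv.swap_apply_of_ne_of_ne (Fin.succ_ne_zero _) (fun hh => hz (Fin.succ_injective _ hh)),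
        Equiv.Perm.decomposeFin_symm_apply_succ, Equiv.swap_apply_of_ne_of_ne (Fin.succ_ne_zero _)
          (fun hh => hz (σ.injective ((Fin.succ_injective _ hh).trans hx.symm)))] at h1
      exact Fin.succ_injective _ h1
  · rintro ⟨h, hx⟩
    refine ⟨by rw [hx, Equiv.swap_apply_right], fun z => ?_⟩
    by_cases hz : σ z = x
    · rw [hz, Equiv.swap_apply_right, Equiv.Perm.decomposeFin_symm_apply_zero,
        σ.injective (hz.trans hx.symm)]
    · rw [Equiv.swap_apply_of_ne_of_ne (Fin.succ_ne_zero _)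
          (fun hh => hz (Fin.succ_injective _ hh)),
        Equiv.Perm.decomposeFin_symm_apply_succ, Equiv.swap_apply_of_ne_of_ne (Fin.succ_ne_zero _)
          (fun hh => hz (σ.injective ((Fin.succ_injective _ hh).trans hx.symm))), h]

theorem card_involutions_fixing (n : ℕ) (x : Fin (n + 1)) :
    ((involutions (n + 1)).filter fun π => π x = x).card = (involutions n).card := by
  have h0 : ((involutions (n + 1)).filter fun π => π 0 = 0).card = (involutions n).card := by
    rw [card_involutions_map_zero]
    simp only [decomposeFin_symm_zero_mem_involutions, filter_univ_mem]
  rw [← h0]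
  refine card_nbij' (fun π => Equiv.swap 0 x * π * Equiv.swap 0 x)
    (fun π => Equiv.swap 0 x * π * Equiv.swap 0 x) ?_ ?_ ?_ ?_
  · intro π hπ
    rw [mem_coe, mem_filter, mem_involutions] at hπ ⊢
    refine ⟨fun z => ?_, ?_⟩
    · simp [Equiv.Perm.mul_apply, hπ.1]
    · simp [Equiv.Perm.mul_apply, hπ.2]
  · intro π hπ
    rw [mem_coe, mem_filter, mem_involutions] at hπ ⊢
    refine ⟨fun z => ?_, ?_⟩
    · simp [Equiv.Perm.mul_apply, hπ.1]
    · simp [Equiv.Perm.mul_apply, hπ.2]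
  · intro π _
    simp only [mul_assoc, Equiv.swap_mul_self, mul_one]
    rw [← mul_assoc, Equiv.swap_mul_self, one_mul]
  · intro π _
    simp only [mul_assoc, Equiv.swap_mul_self, mul_one]
    rw [← mul_assoc, Equiv.swap_mul_self, one_mul]

theorem card_involutions_succ_succ (n : ℕ) :
    (involutions (n + 2)).card = (involutions (n + 1)).card + (n + 1) * (involutions n).card := by
  have h := card_eq_sum_card_fiberwise (s := involutions (n + 2)) (t := univ) (f := fun π => π 0)
    (fun _ _ => mem_univ _)
  rw [h, Fin.sum_univ_succ]
  simp only [card_involutions_map_zero, decomposeFin_symm_zero_mem_involutions,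
    decomposeFin_symm_succ_mem_involutions, filter_univ_mem]
  have h2 : ∀ x : Fin (n + 1), (univ.filter fun σ : Equiv.Perm (Fin (n + 1)) =>
      σ ∈ involutions (n + 1) ∧ σ x = x).card = (involutions n).card := by
    intro x
    rw [← card_involutions_fixing n x, ← filter_filter, filter_univ_mem]
  simp only [h2, sum_const, card_univ, Fintype.card_fin, smul_eq_mul]

/-- The number of standard Young tableaux of size `n` is the number of involutions. -/
theorem upOp_one_pow_eq_card_involutions (n : ℕ) :
    (upOp 1 ^ n) (fun _ => 1) ⊥ = ((involutions n).card : ℝ) := by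
  induction n using Nat.twoStepInduction with
  | zero =>
    have h : (involutions 0).card = 1 := by decide
    rw [h, pow_zero, Nat.cast_one]
    rfl
  | one =>
    have h : (involutions 1).card = 1 := by decide
    rw [h, pow_one, upOp_apply]
    simp only [sum_const, card_addStrip, sum_range_succ, removeStrip_zero,
      removeStrip_bot one_ne_zero]
    simp
  | more n ih1 ih2 =>
    rw [upOp_one_pow_one_apply_bot, ih1, ih2, card_involutions_succ_succ]
    push_cast
    ring

/-! ### Asymptotics for `q ≠ 1` -/

theorem qPoch_pos {q : ℝ} (hq : 0 ≤ q) (hq1 : q < 1) (n : ℕ) : 0 < qPoch q n :=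
  prod_pos fun i _ => sub_pos.2 (pow_lt_one₀ hq hq1 i.succ_ne_zero)

theorem evenCoeff_nonneg {q : ℝ} (hq : 0 ≤ q) (hq1 : q < 1) (n : ℕ) : 0 ≤ evenCoeff q n := by
  rw [evenCoeff]
  split_ifs
  · exact mul_nonneg (pow_nonneg hq _) (inv_nonneg.2 (qPoch_pos hq hq1 _).le)
  · exact le_rfl

theorem summable_evenCoeff {q : ℝ} (hq : 0 < q) (hq1 : q < 1) : Summable (evenCoeff q) := by
  have h : Summable fun l => q ^ l * (qPoch q l)⁻¹ := by
    refine summable_of_ratio_test_tendsto_lt_one hq1 (Filter.Eventually.of_forall fun l =>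
      (mul_pos (pow_pos hq _) (inv_pos.2 (qPoch_pos hq.le hq1 _))).ne') ?_
    have h1 : Filter.Tendsto (fun l : ℕ => q * (1 - q ^ (l + 1))⁻¹) Filter.atTop
        (nhds (q * (1 - 0)⁻¹)) := by
      refine Filter.Tendsto.const_mul _ (Filter.Tendsto.inv₀ (tendsto_const_nhds.sub ?_) (by simp))
      exact (tendsto_pow_atTop_nhds_zero_of_lt_one hq.le hq1).comp (Filter.tendsto_add_atTop_nat 1)
    rw [sub_zero, inv_one, mul_one] at h1
    refine h1.congr fun l => ?_
    have h2 := qPoch_pos hq.le hq1 l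
    have h3 := qPoch_pos hq.le hq1 (l + 1)
    have h4 : 0 < 1 - q ^ (l + 1) := sub_pos.2 (pow_lt_one₀ hq.le hq1 l.succ_ne_zero)
    rw [Real.norm_of_nonneg (by positivity), Real.norm_of_nonneg (by positivity), qPoch_succ]
    field_simp
    ring
  have hinj : Function.Injective fun l : ℕ => 2 * l := fun a b h => by simpa using h
  rw [← hinj.summable_iff]
  · refine h.congr fun l => ?_
    simp [evenCoeff]
  · intro n hn
    rw [evenCoeff, if_neg]
    rintro ⟨l, rfl⟩
    exact hn ⟨l, two_mul l⟩

theorem sCoeff_eq (q : ℝ) (n : ℕ) : sCoeff q n = ∑ k ∈ range (n + 1), evenCoeff q k := by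
  rw [sCoeff, ← Finset.Nat.sum_antidiagonal_swap,
    Finset.Nat.sum_antidiagonal_eq_sum_range_succ_mk]
  rfl

theorem tau_nonneg {q : ℝ} (hq : 0 < q) (hq1 : q < 1) (n : ℕ) : 0 ≤ tau q n := by
  rw [tau_eq]
  exact mul_nonneg (inv_nonneg.2 (qPoch_pos hq.le hq1 _).le) (tMaj_nonneg hq.le n)

theorem tau_eq_sum_range {q : ℝ} (hq : ∀ n : ℕ, 0 < n → q ^ n ≠ 1) (n : ℕ) :
    tau q n = ∑ j ∈ range (n + 1), sCoeff q (n - j) * (q ^ j * tau q j) := by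
  have h := congrArg (PowerSeries.coeff n) (tau_eq_sum hq)
  rw [PowerSeries.coeff_mk, PowerSeries.coeff_mul, ← Finset.Nat.sum_antidiagonal_swap,
    Finset.Nat.sum_antidiagonal_eq_sum_range_succ_mk] at h
  simpa only [Prod.swap, PowerSeries.coeff_mk, coeff_rescaleX, smul_eq_mul] using h

/-- For `q < 1` the normalized numbers `t_n(q) / (q; q)_n` converge to a positive limit. -/
theorem exists_tendsto_tau {q : ℝ} (hq : 0 < q) (hq1 : q < 1) :
    ∃ L : ℝ, 0 < L ∧ Filter.Tendsto (tau q) Filter.atTop (nhds L) := by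
  have hq' := pow_ne_one_of_pos hq hq1.ne
  have hsum := summable_evenCoeff hq hq1
  have hnn := evenCoeff_nonneg hq.le hq1
  have hτ := tau_nonneg hq hq1
  set B := ∑' n, evenCoeff q n with hB
  have hs0 : ∀ n, 0 ≤ sCoeff q n := fun n => sum_nonneg fun _ _ => hnn _
  have hsB : ∀ n, sCoeff q n ≤ B := fun n => by
    rw [sCoeff_eq]
    exact hsum.sum_le_tsum _ fun _ _ => hnn _
  have hslim : Filter.Tendsto (sCoeff q) Filter.atTop (nhds B) := by
    simp only [funext (sCoeff_eq q)]
    exact hsum.hasSum.tendsto_sum_nat.comp (Filter.tendsto_add_atTop_nat 1)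
  have hB1 : 1 ≤ B := (coeff_zero_sCoeff q).symm.le.trans (hsB 0)
  set a : ℕ → ℝ := fun j => q ^ j * tau q j with ha
  have ha0 : ∀ j, 0 ≤ a j := fun j => mul_nonneg (pow_nonneg hq.le _) (hτ j)
  set C := B / (1 - q) with hC
  have hq1' : 0 < 1 - q := sub_pos.2 hq1
  have hC0 : 0 ≤ C := div_nonneg (by linarith) hq1'.le
  have hstep : ∀ n, 0 < n → a n ≤ C * q ^ n * ∑ j ∈ range n, a j := by
    intro n hn
    have h1 := tau_eq_sum_range hq' n
    rw [sum_range_succ, Nat.sub_self, coeff_zero_sCoeff, one_mul] at h1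
    have h2 : ∑ j ∈ range n, sCoeff q (n - j) * (q ^ j * tau q j) ≤ B * ∑ j ∈ range n, a j := by
      rw [mul_sum]
      exact sum_le_sum fun j _ => mul_le_mul_of_nonneg_right (hsB _) (ha0 j)
    have h3 : q ^ n ≤ q := pow_le_of_le_one hq.le hq1.le hn.ne'
    have h4 : (1 - q) * tau q n ≤ B * ∑ j ∈ range n, a j := by
      have := mul_le_mul_of_nonneg_right h3 (hτ n)
      linarith
    have h5 : tau q n ≤ C * ∑ j ∈ range n, a j := by
      rw [hC, div_mul_eq_mul_div, le_div_iff₀ hq1', mul_comm]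
      exact h4
    calc a n ≤ q ^ n * (C * ∑ j ∈ range n, a j) :=
          mul_le_mul_of_nonneg_left h5 (pow_nonneg hq.le _)
      _ = _ := by ring
  have hbound : ∀ n, ∑ j ∈ range n, a j ≤ Real.exp (C * ∑ j ∈ range n, q ^ j) := by
    intro n
    induction n with
    | zero => simp
    | succ n ih =>
      rcases Nat.eq_zero_or_pos n with rfl | hn
      · simp only [zero_add, range_one, sum_singleton, ha, pow_zero, tau_zero, mul_one]
        exact Real.one_le_exp hC0
      rw [sum_range_succ, sum_range_succ, mul_add, Real.exp_add]
      have h1 := hstep n hn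
      have h2 := Real.add_one_le_exp (C * q ^ n)
      have h3 : 0 ≤ ∑ j ∈ range n, a j := sum_nonneg fun _ _ => ha0 _
      calc _ ≤ (∑ j ∈ range n, a j) * (C * q ^ n + 1) := by linarith
        _ ≤ _ := mul_le_mul ih h2 (by positivity) (Real.exp_pos _).le
  have hgeom : ∀ n, ∑ j ∈ range n, q ^ j ≤ (1 - q)⁻¹ := fun n => by
    rw [← tsum_geometric_of_lt_one hq.le hq1]
    exact (summable_geometric_of_lt_one hq.le hq1).sum_le_tsum _ fun _ _ => pow_nonneg hq.le _
  have hasum : Summable a := summable_of_sum_range_le ha0 fun n =>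
    (hbound n).trans (Real.exp_le_exp.2 (mul_le_mul_of_nonneg_left (hgeom n) hC0))
  refine ⟨∑' j, B * a j, ?_, ?_⟩
  · have h0 : a 0 = 1 := by simp only [ha, pow_zero, tau_zero, mul_one]
    refine (hasum.mul_left B).tsum_pos (fun j => mul_nonneg (by linarith) (ha0 j)) 0 ?_
    rw [h0]
    linarith
  · have h := tendsto_tsum_of_dominated_convergence (𝓕 := Filter.atTop)
      (f := fun (n j : ℕ) => if j ∈ range (n + 1) then sCoeff q (n - j) * a j else 0)
      (g := fun j => B * a j) (bound := fun j => B * a j) (hasum.mul_left B) ?_ ?_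
    · refine h.congr fun n => ?_
      rw [tau_eq_sum_range hq' n]
      exact (tsum_eq_sum (s := range (n + 1)) fun j hj => if_neg hj).trans
        (sum_congr rfl fun j hj => if_pos hj)
    · intro j
      have hsh : Filter.Tendsto (fun n => sCoeff q (n - j)) Filter.atTop (nhds B) :=
        hslim.comp (Filter.tendsto_sub_atTop_nat j)
      refine (hsh.mul_const (a j)).congr' ?_
      filter_upwards [Filter.eventually_ge_atTop j] with n hn
      rw [if_pos (mem_range.2 (by omega))]
    · refine Filter.Eventually.of_forall fun n j => ?_
      split_ifs
      · rw [Real.norm_of_nonneg (mul_nonneg (hs0 _) (ha0 j))]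
        exact mul_le_mul_of_nonneg_right (hsB _) (ha0 j)
      · rw [norm_zero]
        exact mul_nonneg (by linarith) (ha0 j)

/-- The coefficients of `∑ X ^ (2 l) / (q; q)_l`. -/
noncomputable def evenExp (q : ℝ) (n : ℕ) : ℝ := if Even n then (qPoch q (n / 2))⁻¹ else 0

theorem mk_evenCoeff {q r : ℝ} (hr : r ^ 2 = q) :
    PowerSeries.mk (evenCoeff q) = rescaleX r (PowerSeries.mk (evenExp q)) := by
  ext n
  rw [coeff_rescaleX, PowerSeries.coeff_mk, PowerSeries.coeff_mk, evenCoeff, evenExp]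
  split_ifs with h
  · rw [← hr, ← pow_mul, Nat.two_mul_div_two_of_even h, smul_eq_mul]
  · rw [smul_zero]

theorem mk_evenExp {q r : ℝ} (hq : ∀ n : ℕ, 0 < n → q ^ n ≠ 1) (hr : r ^ 2 = q) :
    (1 - PowerSeries.X ^ 2) * PowerSeries.mk (evenExp q) =
      rescaleX r (PowerSeries.mk (evenExp q)) := by
  rw [← mk_evenCoeff hr]
  ext n
  rw [sub_mul, one_mul, map_sub, PowerSeries.coeff_X_pow_mul']
  simp only [PowerSeries.coeff_mk]
  rw [evenExp, evenExp, evenCoeff]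
  rcases Nat.lt_or_ge n 2 with h | h
  · rw [if_neg (show ¬ 2 ≤ n by omega)]
    interval_cases n <;> simp
  · obtain ⟨k, rfl⟩ : ∃ k, n = k + 2 := ⟨n - 2, by omega⟩
    rw [if_pos h, Nat.add_sub_cancel, Nat.add_div_right k two_pos]
    simp only [show Even (k + 2) ↔ Even k by simp [Nat.even_add]]
    split_ifs
    · linear_combination inv_qPoch_succ hq (k / 2)
    · simp

/-! ### The reciprocity `q ↦ q⁻¹` -/

section RescaleComp

variable {S : Type*} [Ring S] [Algebra ℝ S]

theorem rescaleX_rescaleX (a b : ℝ) (f : PowerSeries S) :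
    rescaleX a (rescaleX b f) = rescaleX (a * b) f := by
  ext n
  rw [coeff_rescaleX, coeff_rescaleX, coeff_rescaleX, smul_smul, mul_pow]

theorem rescaleX_one_left (f : PowerSeries S) : rescaleX 1 f = f := by
  ext n
  rw [coeff_rescaleX, one_pow, one_smul]

theorem rescaleX_one_right (a : ℝ) : rescaleX a (1 : PowerSeries S) = 1 := by
  simpa using rescaleX_C a (1 : S)

theorem coeff_zero_rescaleX (a : ℝ) (f : PowerSeries S) :
    PowerSeries.coeff 0 (rescaleX a f) = PowerSeries.coeff 0 f := by
  rw [coeff_rescaleX, pow_zero, one_smul]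

theorem rescaleX_X (a : ℝ) : rescaleX a (PowerSeries.X : PowerSeries S) = a • PowerSeries.X := by
  ext n
  rw [coeff_rescaleX, PowerSeries.coeff_smul, PowerSeries.coeff_X]
  split_ifs with h <;> simp [h]

end RescaleComp

theorem mk_evenCoeff_mul_inv {q : ℝ} (hq : 0 < q) (hq1 : q ≠ 1) :
    PowerSeries.mk (evenCoeff q) * PowerSeries.mk (evenCoeff q⁻¹) = 1 - PowerSeries.X ^ 2 := by
  set r := √q with hr
  have hr0 : 0 < r := Real.sqrt_pos.2 hq
  have hrq : r ^ 2 = q := Real.sq_sqrt hq.le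
  have hr1 : r ≠ 1 := by
    rintro h
    rw [h, one_pow] at hrq
    exact hq1 hrq.symm
  have hrp : r⁻¹ ^ 2 = q⁻¹ := by rw [inv_pow, hrq]
  have h1 := mk_evenExp (pow_ne_one_of_pos hq hq1) hrq
  have h2 := mk_evenExp (pow_ne_one_of_pos (inv_pos.2 hq) (inv_ne_one.2 hq1)) hrp
  have h3 : PowerSeries.mk (evenExp q) * rescaleX r⁻¹ (PowerSeries.mk (evenExp q⁻¹)) = 1 := by
    refine eq_of_functional_equation (pow_ne_one_of_pos hr0 hr1) (A := 1) (B := 1) (by simp)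
      (by simp) ?_ ?_ ?_
    · rw [PowerSeries.coeff_mul]
      simp [coeff_rescaleX, evenExp, qPoch_zero]
    · rw [one_mul, mul_one, rescaleX_mul, rescaleX_rescaleX, mul_inv_cancel₀ hr0.ne',
        rescaleX_one_left, ← h1, ← h2]
      ring
    · rw [one_mul, mul_one, rescaleX_one_right]
  rw [mk_evenCoeff hrq, mk_evenCoeff hrp, ← h1, mul_assoc, h3, mul_one]

theorem mk_sCoeff_mul_inv {q : ℝ} (hq : 0 < q) (hq1 : q ≠ 1) :
    PowerSeries.mk (sCoeff q) * rescaleX (-1) (PowerSeries.mk (sCoeff q⁻¹)) = 1 := by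
  have h1 := mk_evenCoeff_mul_inv hq hq1
  have h2 : rescaleX (-1) (PowerSeries.mk (evenCoeff q⁻¹)) = PowerSeries.mk (evenCoeff q⁻¹) := by
    ext n
    rw [coeff_rescaleX, PowerSeries.coeff_mk, evenCoeff]
    split_ifs with h
    · rw [h.neg_one_pow, one_smul]
    · rw [smul_zero]
  have h3 : PowerSeries.mk (fun _ => (1 : ℝ)) * (1 - PowerSeries.X) = 1 :=
    PowerSeries.mk_one_mul_one_sub_eq_one ℝ
  have h4 := congrArg (rescaleX (-1)) h3
  rw [rescaleX_mul, rescaleX_sub, rescaleX_one_right, rescaleX_X, neg_one_smul,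
    sub_neg_eq_add] at h4
  rw [mk_sCoeff, mk_sCoeff, rescaleX_mul, h2]
  set G := PowerSeries.mk fun _ => (1 : ℝ)
  calc _ = G * rescaleX (-1) G *
        (PowerSeries.mk (evenCoeff q) * PowerSeries.mk (evenCoeff q⁻¹)) := by ring
    _ = (G * (1 - PowerSeries.X)) * (rescaleX (-1) G * (1 + PowerSeries.X)) := by
      rw [h1]
      ring
    _ = 1 := by rw [h3, h4, one_mul]

theorem tau_eq_inv {q : ℝ} (hq : 0 < q) (hq1 : q ≠ 1) (n : ℕ) :
    tau q n = (-q⁻¹) ^ n * tau q⁻¹ n := by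
  have hs := mk_sCoeff_mul_inv hq hq1
  have hT := tau_eq_sum (pow_ne_one_of_pos (inv_pos.2 hq) (inv_ne_one.2 hq1))
  have h : PowerSeries.mk (tau q) = rescaleX (-q⁻¹) (PowerSeries.mk (tau q⁻¹)) := by
    refine eq_of_functional_equation (pow_ne_one_of_pos hq hq1) (A := PowerSeries.mk (sCoeff q))
      (B := 1) ?_ (by simp) ?_ ?_ ?_
    · rw [PowerSeries.coeff_mk, coeff_zero_sCoeff]
    · rw [coeff_zero_rescaleX, PowerSeries.coeff_mk, PowerSeries.coeff_mk, tau_zero, tau_zero]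
    · rw [mul_one, ← tau_eq_sum (pow_ne_one_of_pos hq hq1)]
    · have hT' := congrArg (rescaleX (-1)) hT
      rw [rescaleX_mul, rescaleX_rescaleX, neg_one_mul] at hT'
      rw [mul_one, rescaleX_rescaleX, mul_neg, mul_inv_cancel₀ hq.ne', hT', ← mul_assoc, hs,
        one_mul]
  have := congrArg (PowerSeries.coeff n) h
  rwa [coeff_rescaleX, PowerSeries.coeff_mk, PowerSeries.coeff_mk, smul_eq_mul] at this

/-! ### Asymptotics of the individual terms -/

/-- The coefficient of the sum of the `f^{α/μ}(q)`, `|μ| = |α| - k`, in the numerator. -/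
noncomputable def termWeight (q : ℝ) (N k : ℕ) : ℝ := qBinom q N k * tMaj q (N - k)

theorem termWeight_eq {q : ℝ} (hq : 0 < q) (hq1 : q ≠ 1) {N k : ℕ} (h : k ≤ N) :
    termWeight q N k = qPoch q N * ((qPoch q k)⁻¹ * tau q (N - k)) := by
  obtain ⟨i, rfl⟩ := Nat.exists_eq_add_of_le' h
  have h1 := qPoch_ne_zero (pow_ne_one_of_pos hq hq1) i
  have h2 := qPoch_ne_zero (pow_ne_one_of_pos hq hq1) k
  rw [termWeight, Nat.add_sub_cancel, tau_eq, ← qBinom_mul_qPoch]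
  field_simp

theorem tendsto_termWeight_of_lt_one {q : ℝ} (hq : 0 < q) (hq1 : q < 1) (m : ℕ) :
    ∃ (c : ℕ → ℝ) (L : ℝ), (∀ N, c N ≠ 0) ∧ L ≠ 0 ∧ ∀ k ≤ m,
      Filter.Tendsto (fun N => termWeight q N k / c N) Filter.atTop
        (nhds (L * ((1 - q) ^ (m - k) / qFact q k))) := by
  obtain ⟨T, hT, hlim⟩ := exists_tendsto_tau hq hq1
  have hq1' : 0 < 1 - q := sub_pos.2 hq1
  refine ⟨qPoch q, T / (1 - q) ^ m, fun N => (qPoch_pos hq.le hq1 N).ne', by positivity,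
    fun k hk => ?_⟩
  have h1 := (hlim.comp (Filter.tendsto_sub_atTop_nat k)).const_mul (qPoch q k)⁻¹
  have h2 : T / (1 - q) ^ m * ((1 - q) ^ (m - k) / qFact q k) = (qPoch q k)⁻¹ * T := by
    have h3 := qFact_pos hq k
    rw [qPoch_eq, ← Nat.sub_add_cancel hk, pow_add, Nat.add_sub_cancel]
    field_simp
  rw [h2]
  refine h1.congr' ?_
  filter_upwards [Filter.eventually_ge_atTop k] with N hN
  rw [termWeight_eq hq hq1.ne hN, mul_div_cancel_left₀ _ (qPoch_pos hq.le hq1 N).ne']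
  rfl

theorem tendsto_termWeight_of_one_lt {q : ℝ} (hq1 : 1 < q) (m : ℕ) :
    ∃ (c : ℕ → ℝ) (L : ℝ), (∀ N, c N ≠ 0) ∧ L ≠ 0 ∧ ∀ k ≤ m,
      Filter.Tendsto (fun N => termWeight q N k / c N) Filter.atTop
        (nhds (L * ((1 - q⁻¹) ^ (m - k) / qFact q k))) := by
  have hq : 0 < q := one_pos.trans hq1
  have hp1 : q⁻¹ < 1 := inv_lt_one_of_one_lt₀ hq1
  obtain ⟨T, hT, hlim⟩ := exists_tendsto_tau (inv_pos.2 hq) hp1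
  have hp1' : 0 < 1 - q⁻¹ := sub_pos.2 hp1
  have hP := qPoch_ne_zero (pow_ne_one_of_pos hq hq1.ne')
  have hp0 : -q⁻¹ ≠ 0 := neg_ne_zero.2 (inv_ne_zero hq.ne')
  refine ⟨fun N => qPoch q N * (-q⁻¹) ^ N, T / (1 - q⁻¹) ^ m,
    fun N => mul_ne_zero (hP N) (pow_ne_zero _ hp0), by positivity, fun k hk => ?_⟩
  have h1 := (hlim.comp (Filter.tendsto_sub_atTop_nat k)).const_mul
    ((qPoch q k)⁻¹ * ((-q⁻¹) ^ k)⁻¹)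
  have h2 : T / (1 - q⁻¹) ^ m * ((1 - q⁻¹) ^ (m - k) / qFact q k) =
      (qPoch q k)⁻¹ * ((-q⁻¹) ^ k)⁻¹ * T := by
    have h3 := qFact_pos hq k
    have h4 : (1 - q) ^ k * (-q⁻¹) ^ k = (1 - q⁻¹) ^ k := by
      rw [← mul_pow]
      congr 1
      field_simp
      ring
    rw [qPoch_eq, ← mul_inv, mul_right_comm, h4, ← Nat.sub_add_cancel hk, pow_add,
      Nat.add_sub_cancel]
    generalize 1 - q⁻¹ = x at hp1'
    field_simp
  rw [h2]
  refine h1.congr' ?_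
  filter_upwards [Filter.eventually_ge_atTop k] with N hN
  obtain ⟨i, rfl⟩ := Nat.exists_eq_add_of_le' hN
  have h3 := hP (i + k)
  rw [termWeight_eq hq hq1.ne' hN, Nat.add_sub_cancel, tau_eq_inv hq hq1.ne', pow_add]
  simp only [Function.comp_apply, Nat.add_sub_cancel]
  have h5 := hP k
  have h6 := pow_ne_zero i hp0
  have h7 := pow_ne_zero k hp0
  field_simp

/-! ### Asymptotics for `q = 1` -/

theorem qBinom_one (n k : ℕ) : qBinom 1 n k = n.choose k := by
  induction n generalizing k with
  | zero => cases k <;> simp [qBinom]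
  | succ n ih =>
    rcases k with _ | k
    · simp [qBinom]
    · rw [qBinom, ih, ih, one_pow, one_mul, Nat.choose_succ_succ, Nat.cast_add]

theorem tMaj_one_succ_succ (n : ℕ) :
    tMaj 1 (n + 2) = tMaj 1 (n + 1) + (n + 1) * tMaj 1 n := by
  simp only [tMaj_one, upOp_one_pow_one_apply_bot]

theorem card_involutions_pos (n : ℕ) : 0 < (involutions n).card :=
  card_pos.2 ⟨1, by simp [involutions]⟩

theorem tMaj_one_pos (n : ℕ) : 0 < tMaj 1 n := by
  rw [tMaj_one, upOp_one_pow_eq_card_involutions, Nat.cast_pos]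
  exact card_involutions_pos n

theorem tMaj_one_succ_bounds (n : ℕ) :
    √(n + 1) * tMaj 1 n ≤ tMaj 1 (n + 1) ∧ tMaj 1 (n + 1) ≤ (√(n + 1) + 1) * tMaj 1 n := by
  induction n with
  | zero =>
    have h : tMaj 1 1 = 1 := by
      rw [tMaj_one, upOp_one_pow_eq_card_involutions, show (involutions 1).card = 1 by decide,
        Nat.cast_one]
    norm_num [tMaj_zero, h]
  | succ n ih =>
    obtain ⟨h1, h2⟩ := ih
    have ha := tMaj_one_pos n
    have hb := tMaj_one_pos (n + 1)
    rw [tMaj_one_succ_succ]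
    push_cast
    set s := √((n : ℝ) + 1) with hs
    set u := √((n : ℝ) + 1 + 1) with hu
    have hs2 : s ^ 2 = n + 1 := Real.sq_sqrt (by positivity)
    have hu2 : u ^ 2 = n + 1 + 1 := Real.sq_sqrt (by positivity)
    have hs0 : 0 ≤ s := Real.sqrt_nonneg _
    have hu0 : 0 ≤ u := Real.sqrt_nonneg _
    have hsu : s ≤ u := Real.sqrt_le_sqrt (by linarith)
    rw [← hs2]
    constructor
    · have h3 : u * (s + 1) ≤ s ^ 2 + s + 1 := by
        refine abs_le_of_sq_le_sq' ?_ (by positivity) |>.2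
        rw [mul_pow, hu2, ← hs2]
        nlinarith [sq_nonneg s]
      have h4 : u * (s + 1) * tMaj 1 (n + 1) ≤ (s ^ 2 + s + 1) * tMaj 1 (n + 1) :=
        mul_le_mul_of_nonneg_right h3 hb.le
      have h5 := mul_le_mul_of_nonneg_left h2 (sq_nonneg s)
      refine le_of_mul_le_mul_left (a := s + 1) ?_ (by positivity)
      nlinarith
    · nlinarith [mul_le_mul_of_nonneg_left h1 hs0, mul_le_mul_of_nonneg_right hsu hb.le]

theorem tendsto_tMaj_one_ratio :
    Filter.Tendsto (fun n : ℕ => tMaj 1 (n + 1) / ((n + 1) * tMaj 1 n)) Filter.atTop (nhds 0) := by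
  have h : Filter.Tendsto (fun n : ℕ => 2 * (√((n : ℝ) + 1))⁻¹) Filter.atTop (nhds 0) := by
    rw [← mul_zero (2 : ℝ)]
    refine (Filter.Tendsto.inv_tendsto_atTop ?_).const_mul 2
    exact Real.tendsto_sqrt_atTop.comp
      (Filter.tendsto_atTop_add_const_right _ 1 tendsto_natCast_atTop_atTop)
  refine squeeze_zero (fun n => ?_) (fun n => ?_) h
  · have h1 := tMaj_one_pos n
    have h2 := tMaj_one_pos (n + 1)
    positivity
  · have h1 := tMaj_one_pos n
    have h2 := (tMaj_one_succ_bounds n).2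
    have h3 : (0 : ℝ) < n + 1 := by positivity
    set s := √((n : ℝ) + 1) with hs
    have hs2 : s ^ 2 = n + 1 := Real.sq_sqrt h3.le
    have hs1 : 1 ≤ s := by
      rw [hs, Real.one_le_sqrt]
      linarith [(Nat.cast_nonneg n : (0 : ℝ) ≤ n)]
    have hs0 : 0 < s := by linarith
    rw [div_le_iff₀ (by positivity), ← hs2]
    refine h2.trans ?_
    have h4 : 2 * s⁻¹ * (s ^ 2 * tMaj 1 n) = 2 * s * tMaj 1 n := by field_simp
    rw [h4]
    exact mul_le_mul_of_nonneg_right (by linarith) h1.le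

theorem termWeight_one_pos {N k : ℕ} (h : k ≤ N) : 0 < termWeight 1 N k := by
  rw [termWeight, qBinom_one]
  exact mul_pos (Nat.cast_pos.2 (Nat.choose_pos h)) (tMaj_one_pos _)

theorem tendsto_termWeight_one_ratio (k : ℕ) :
    Filter.Tendsto (fun N => termWeight 1 N k / termWeight 1 N (k + 1)) Filter.atTop
      (nhds 0) := by
  have h := (tendsto_tMaj_one_ratio.comp (Filter.tendsto_sub_atTop_nat (k + 1))).const_mul
    ((k : ℝ) + 1)
  rw [mul_zero] at h
  refine h.congr' ?_
  filter_upwards [Filter.eventually_ge_atTop (k + 1)] with N hN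
  obtain ⟨n, rfl⟩ := Nat.exists_eq_add_of_le' hN
  have h1 : (((n + (k + 1)).choose (k + 1) : ℕ) : ℝ) * (k + 1) =
      ((n + (k + 1)).choose k : ℕ) * (n + 1) := by
    have := Nat.choose_succ_right_eq (n + (k + 1)) k
    rw [show n + (k + 1) - k = n + 1 by omega] at this
    exact_mod_cast this
  have h2 := tMaj_one_pos n
  have h3 : (0 : ℝ) < (n + (k + 1)).choose (k + 1) := Nat.cast_pos.2 (Nat.choose_pos (by omega))
  rw [Function.comp_apply, Nat.add_sub_cancel, termWeight, termWeight, qBinom_one, qBinom_one,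
    Nat.add_sub_cancel, show n + (k + 1) - k = n + 1 by omega, ← mul_div_assoc,
    div_eq_div_iff (by positivity) (by positivity)]
  linear_combination tMaj 1 (n + 1) * tMaj 1 n * h1

theorem tendsto_termWeight_one {m : ℕ} (d k : ℕ) (h : k + d = m) :
    Filter.Tendsto (fun N => termWeight 1 N k / termWeight 1 N m) Filter.atTop
      (nhds (0 ^ d)) := by
  induction d generalizing k with
  | zero =>
    obtain rfl : k = m := h
    rw [pow_zero]
    refine tendsto_const_nhds.congr' ?_
    filter_upwards [Filter.eventually_ge_atTop k] with N hN
    rw [div_self (termWeight_one_pos hN).ne']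
  | succ d ih =>
    rw [pow_succ']
    refine ((tendsto_termWeight_one_ratio k).mul (ih (k + 1) (by omega))).congr' ?_
    filter_upwards [Filter.eventually_ge_atTop (k + 1)] with N hN
    rw [div_mul_div_cancel₀ (termWeight_one_pos hN).ne']

theorem exists_tendsto_termWeight {q : ℝ} (hq : 0 < q) (m : ℕ) :
    ∃ (c : ℕ → ℝ) (L : ℝ), (∀ᶠ N in Filter.atTop, c N ≠ 0) ∧ L ≠ 0 ∧ ∀ k ≤ m,
      Filter.Tendsto (fun N => termWeight q N k / c N) Filter.atTop
        (nhds (L * ((1 - min q q⁻¹) ^ (m - k) / qFact q k))) := by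
  rcases lt_trichotomy q 1 with hq1 | rfl | hq1
  · obtain ⟨c, L, hc, h⟩ := tendsto_termWeight_of_lt_one hq hq1 m
    rw [min_eq_left (hq1.le.trans (one_lt_inv₀ hq |>.2 hq1).le)]
    exact ⟨c, L, Filter.Eventually.of_forall hc, h⟩
  · refine ⟨fun N => termWeight 1 N m, qFact 1 m, ?_, (qFact_pos one_pos m).ne', fun k hk => ?_⟩
    · filter_upwards [Filter.eventually_ge_atTop m] with N hN
      exact (termWeight_one_pos hN).ne'
    · have h := tendsto_termWeight_one (m := m) (m - k) k (by omega)
      have h1 : qFact 1 m * ((1 - min 1 1⁻¹) ^ (m - k) / qFact 1 k) = 0 ^ (m - k) := by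
        rw [inv_one, min_self, sub_self]
        rcases hk.eq_or_lt with rfl | hlt
        · rw [Nat.sub_self, pow_zero, mul_one_div_cancel (qFact_pos one_pos k).ne']
        · rw [zero_pow (by omega), zero_div, mul_zero]
      rwa [h1]
  · obtain ⟨c, L, hc, h⟩ := tendsto_termWeight_of_one_lt hq1 m
    rw [min_eq_right ((inv_lt_one_of_one_lt₀ hq1).le.trans hq1.le)]
    exact ⟨c, L, Filter.Eventually.of_forall hc, h⟩

/-! ### The limit of the ratio -/

theorem skewSum_of_card_lt {q : ℝ} {k : ℕ} {α : YoungDiagram} (h : α.card < k) :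
    skewSum q k α = 0 := if_neg h.not_ge

theorem majOp_one_apply_eq_sum_range {q : ℝ} (hq : 0 < q) {N m : ℕ} (hN : m ≤ N)
    (α : YoungDiagram) (hα : α.card ≤ m) :
    majOp q N (fun _ => 1) α = ∑ k ∈ range (m + 1), termWeight q N k * skewSum q k α := by
  rw [majOp_one_apply hq, ← Finset.Nat.sum_antidiagonal_swap,
    Finset.Nat.sum_antidiagonal_eq_sum_range_succ_mk]
  refine (sum_subset (range_mono (by omega)) fun k _ hk => ?_).symm
  rw [mem_range, not_lt] at hk
  exact mul_eq_zero_of_right _ (skewSum_of_card_lt (by lia : α.card < k))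

theorem upOp_pow_majOp_one_apply_bot {q : ℝ} (hq : 0 < q) {N m : ℕ} (hN : m ≤ N) :
    (upOp 1 ^ m) (majOp q N fun _ => 1) ⊥ = ∑ k ∈ range (m + 1),
      termWeight q N k * (m.choose k * (qFact q k * ((involutions (m - k)).card : ℝ))) := by
  have h : majOp q N (fun _ => 1) = ∑ k ∈ range (N + 1), termWeight q N k • skewSum q k := by
    ext α
    rw [majOp_one_apply hq, ← Finset.Nat.sum_antidiagonal_swap,
      Finset.Nat.sum_antidiagonal_eq_sum_range_succ_mk, Finset.sum_apply]
    rfl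
  rw [h, map_sum, Finset.sum_apply]
  simp only [map_smul, Pi.smul_apply, smul_eq_mul, upOp_pow_skewSum hq,
    upOp_one_pow_eq_card_involutions]
  refine (sum_subset (range_mono (by omega)) fun k _ hk => ?_).symm
  rw [mem_range, not_lt] at hk
  rw [Nat.choose_eq_zero_of_lt (by omega), Nat.cast_zero, zero_mul, mul_zero]

open scoped Classical in
theorem le_of_mem_skewSYT {mu lam : YoungDiagram} {n : ℕ} {c : Fin (n + 1) → YoungDiagram}
    (h : c ∈ skewSYT mu lam n) : mu ≤ lam := by
  rw [skewSYT, mem_filter, Fintype.mem_piFinset] at h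
  exact h.2.1 ▸ mem_subDiagrams.1 (h.1 0)

open scoped Classical in
theorem skewSum_eq_sum_subDiagrams {q : ℝ} {α : YoungDiagram} {k j : ℕ} (h : j + k = α.card) :
    skewSum q k α = ∑ μ ∈ (subDiagrams α).filter (fun μ => μ.card = j), fSkew μ α k q := by
  rw [skewSum, if_pos (by omega)]
  refine (sum_subset (fun μ hμ => ?_) fun μ hμ hμ' => ?_).symm
  · rw [mem_diagramsOfCard, (mem_filter.1 hμ).2]
    omega
  · rw [mem_diagramsOfCard] at hμ
    refine sum_eq_zero fun c hc => (hμ' ?_).elim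
    exact mem_filter.2 ⟨mem_subDiagrams.2 (le_of_mem_skewSYT hc), by omega⟩

/-- The limit of the ratio, with the sums indexed by `k = m - j`. -/
theorem tendsto_ratio {q : ℝ} (hq : 0 < q) {m : ℕ} (x y : ℕ → ℝ)
    (hy : ∀ k, 0 ≤ y k) (hym : 0 < y m) :
    Filter.Tendsto (fun N => (∑ k ∈ range (m + 1), termWeight q N k * x k) /
        ∑ k ∈ range (m + 1), termWeight q N k * (qFact q k * y k)) Filter.atTop
      (nhds ((∑ k ∈ range (m + 1), (1 - min q q⁻¹) ^ (m - k) / qFact q k * x k) /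
        ∑ k ∈ range (m + 1), (1 - min q q⁻¹) ^ (m - k) * y k)) := by
  obtain ⟨c, L, hc, hL, h⟩ := exists_tendsto_termWeight hq m
  have hlim : ∀ z : ℕ → ℝ, Filter.Tendsto
      (fun N => (∑ k ∈ range (m + 1), termWeight q N k * z k) / c N) Filter.atTop
      (nhds (L * ∑ k ∈ range (m + 1), (1 - min q q⁻¹) ^ (m - k) / qFact q k * z k)) := by
    intro z
    simp only [mul_sum, sum_div, ← mul_assoc, mul_div_right_comm _ (z _)]
    exact tendsto_finsetSum _ fun k hk =>
      (h k (Nat.lt_succ_iff.1 (mem_range.1 hk))).mul_const _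
  have hden : ∑ k ∈ range (m + 1), (1 - min q q⁻¹) ^ (m - k) / qFact q k * (qFact q k * y k) =
      ∑ k ∈ range (m + 1), (1 - min q q⁻¹) ^ (m - k) * y k :=
    sum_congr rfl fun k _ => by rw [← mul_assoc, div_mul_cancel₀ _ (qFact_pos hq k).ne']
  have hq1 : 0 ≤ 1 - min q q⁻¹ := by
    rw [sub_nonneg, min_le_iff]
    exact (le_total q 1).imp_right inv_le_one_of_one_le₀
  have hpos : 0 < ∑ k ∈ range (m + 1), (1 - min q q⁻¹) ^ (m - k) * y k := by
    refine sum_pos' (fun k _ => mul_nonneg (pow_nonneg hq1 _) (hy k)) ⟨m, self_mem_range_succ m, ?_⟩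
    rwa [Nat.sub_self, pow_zero, one_mul]
  have h1 := (hlim x).div (hlim fun k => qFact q k * y k) (by
    rw [hden]
    exact mul_ne_zero hL hpos.ne')
  rw [hden, mul_div_mul_left _ _ hL] at h1
  refine h1.congr' ?_
  filter_upwards [hc] with N hN
  exact div_div_div_cancel_right₀ hN _ _

open scoped Classical in
/-- For a standard Young tableau `A` of shape `α ⊢ m` and real `q > 0`,
`(Σ_{T ∈ T_n(A)} q^{maj(T_{>m})})/(Σ_{T ∈ T_n} q^{maj(T_{>m})})` tends to
`(Σ_{j=0}^m [m choose j]_q [j]_q! (1-q̄)^j Σ_{μ ⊢ j} f^{α/μ}(q)) /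
 (Σ_{j=0}^m [m]_q! t_j C(m,j) (1-q̄)^j)`. -/
theorem stmt13 {m : ℕ} (α : YoungDiagram) (hα : α.card = m)
    (A : Fin (m + 1) → YoungDiagram) (hA : A ∈ skewSYT ⊥ α m) (q : ℝ) (hq : 0 < q) :
    Filter.Tendsto (fun n : ℕ =>
        (∑ T ∈ (allSYT n).filter (fun T => containsT T A),
            q ^ chainMaj (tailChain T m)) /
          (∑ T ∈ allSYT n, q ^ chainMaj (tailChain T m)))
      Filter.atTop
      (nhds ((∑ j ∈ Finset.range (m + 1),
              qBinom q m j * qFact q j * (1 - min q q⁻¹) ^ j *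
                ∑ μ ∈ (subDiagrams α).filter (fun μ => μ.card = j),
                  fSkew μ α (m - j) q) /
        (∑ j ∈ Finset.range (m + 1), qFact q m * ((involutions j).card : ℝ) *
              (m.choose j : ℝ) * (1 - min q q⁻¹) ^ j))) := by
  set F : ℕ → ℝ := fun n => (∑ T ∈ (allSYT n).filter (fun T => containsT T A),
    q ^ chainMaj (tailChain T m)) / ∑ T ∈ allSYT n, q ^ chainMaj (tailChain T m) with hF
  suffices h : Filter.Tendsto (fun N => F (m + N)) Filter.atTop (nhds _) from
    (Filter.tendsto_add_atTop_iff_nat m).1 (h.congr fun N => congrArg F (add_comm m N))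
  have h := tendsto_ratio hq (m := m) (fun k => skewSum q k α)
    (fun k => m.choose k * ((involutions (m - k)).card : ℝ)) (fun k => by positivity)
    (mul_pos (by simp) (Nat.cast_pos.2 (card_involutions_pos _)))
  have hlim : (∑ k ∈ range (m + 1), (1 - min q q⁻¹) ^ (m - k) / qFact q k * skewSum q k α) /
      ∑ k ∈ range (m + 1), (1 - min q q⁻¹) ^ (m - k) *
        (m.choose k * ((involutions (m - k)).card : ℝ)) =
      (∑ j ∈ range (m + 1), qBinom q m j * qFact q j * (1 - min q q⁻¹) ^ j *
          ∑ μ ∈ (subDiagrams α).filter (fun μ => μ.card = j), fSkew μ α (m - j) q) /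
        ∑ j ∈ range (m + 1), qFact q m * ((involutions j).card : ℝ) * (m.choose j : ℝ) *
          (1 - min q q⁻¹) ^ j := by
    rw [← mul_div_mul_left _ _ (qFact_pos hq m).ne', mul_sum, mul_sum, ← sum_range_reflect]
    congr 1
    · refine sum_congr rfl fun j hj => ?_
      obtain ⟨i, rfl⟩ := Nat.exists_eq_add_of_le' (Nat.lt_succ_iff.1 (mem_range.1 hj))
      have h1 := qFact_pos hq i
      rw [show i + j + 1 - 1 - j = i by omega, Nat.add_sub_cancel_left, Nat.add_sub_cancel,
        skewSum_eq_sum_subDiagrams (j := j) (by omega), ← qBinom_mul_qFact]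
      field_simp
    · rw [← sum_range_reflect]
      refine sum_congr rfl fun j hj => ?_
      have hj' := Nat.lt_succ_iff.1 (mem_range.1 hj)
      rw [Nat.add_sub_cancel, Nat.sub_sub_self hj', Nat.choose_symm hj']
      ring
  rw [← hlim]
  refine h.congr' ?_
  filter_upwards [Filter.eventually_ge_atTop m] with N hN
  rw [hF]
  simp only
  rw [sum_allSYT_tail, sum_allSYT_contains q hA, upOp_pow_majOp_one_apply_bot hq hN,
    majOp_one_apply_eq_sum_range hq hN α hα.le]
  congr 1
  refine sum_congr rfl fun k _ => ?_
  ring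

end QT
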